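/- Fix an integer d ≥ 2 and a real c > 0. Then there exists δ > 0 (depending only on d and c) such that asymptotically almost surely the following holds for Y = Y_d(n, c/n): every nonzero vector z ∈ ker ∂_d(Y) whose support is inclusion-minimal among supports of nonzero elements of ker ∂_d(Y) either has support equal to the set of all (d+1)-element subsets of some (d+2)-element subset of [n] (i.e., z is a scalar multiple of the boundary of a (d+1)-simplex), or has support of size at least δ·n^d. -/

import Mathlib

open Finset Filter
open scoped Classical

noncomputable section

/-- The set of all possible `d`-faces: `(d+1)`-element subsets of `[n]`. -/
def allFaces (n d : ℕ) : Finset (Finset (Fin n)) :=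
  Finset.univ.filter (fun σ => σ.card = d + 1)

/-- Probability of the event `E` under `Y_d(n,p)`. -/
def probY (n d : ℕ) (p : ℝ) (E : Finset (Finset (Fin n)) → Prop) : ℝ :=
  ∑ F ∈ (allFaces n d).powerset,
    if E F then p ^ F.card * (1 - p) ^ ((allFaces n d).card - F.card) else 0

/-- Expectation of `X` under `Y_d(n,p)`. -/
def expectY (n d : ℕ) (p : ℝ) (X : Finset (Finset (Fin n)) → ℝ) : ℝ :=
  ∑ F ∈ (allFaces n d).powerset,
    p ^ F.card * (1 - p) ^ ((allFaces n d).card - F.card) * X F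

/-- Coefficient of the `d`-face `τ` in the boundary of `σ`. -/
def bdCoeff {n : ℕ} (τ σ : Finset (Fin n)) : ℝ :=
  if τ ⊆ σ ∧ τ.card + 1 = σ.card then
    ∑ v ∈ σ \ τ, (-1 : ℝ) ^ (σ.filter (fun w => w < v)).card
  else 0

/-- The boundary operator `∂_d(F) : ℝ^F → ℝ^{(d-1)-faces}`. -/
def boundaryMap (n : ℕ) (F : Finset (Finset (Fin n))) :
    (↥F → ℝ) →ₗ[ℝ] (Finset (Fin n) → ℝ) where
  toFun x := fun τ => ∑ σ ∈ F.attach, x σ * bdCoeff τ σ.1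
  map_add' x y := by
    funext τ
    simp [add_mul, Finset.sum_add_distrib]
  map_smul' c x := by
    funext τ
    simp [Finset.mul_sum, mul_assoc]

/-- Dimension of the kernel of `∂_d(F)`, i.e. `dim H_d`. -/
def dimKer (n : ℕ) (F : Finset (Finset (Fin n))) : ℕ :=
  Module.finrank ℝ (LinearMap.ker (boundaryMap n F))

/-- The real shadow of `F`. -/
def shadowR (n d : ℕ) (F : Finset (Finset (Fin n))) : Finset (Finset (Fin n)) :=
  (allFaces n d).filter (fun σ => σ ∉ F ∧ dimKer n F < dimKer n (insert σ F))

/-- The `(d+2)`-subsets all of whose `(d+1)`-subsets are faces of `F`. -/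
def simplexBoundaries (n d : ℕ) (F : Finset (Finset (Fin n))) : Finset (Finset (Fin n)) :=
  Finset.univ.filter (fun τ => τ.card = d + 2 ∧ ∀ s ∈ τ.powerset, s.card = d + 1 → s ∈ F)

/-- The boundary cycle of the `(d+2)`-subset `τ`, as a vector in `ℝ^F`. -/
def simplexCycle (n : ℕ) (F : Finset (Finset (Fin n))) (τ : Finset (Fin n)) : ↥F → ℝ :=
  fun σ => bdCoeff σ.1 τ


/-- The support of a vector `z : ℝ^F`, as a set of faces. -/
def suppOf {n : ℕ} {F : Finset (Finset (Fin n))} (z : ↥F → ℝ) : Finset (Finset (Fin n)) :=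
  (Finset.univ.filter (fun σ : ↥F => z σ ≠ 0)).image Subtype.val


lemma wsum_aux {α : Type*} [DecidableEq α] (V A D : Finset α) (hA : A ⊆ V) (hD : D ⊆ V)
    (hAD : Disjoint A D) (p : ℝ) :
    ∑ F ∈ V.powerset.filter (fun F => A ⊆ F ∧ Disjoint F D),
      p ^ F.card * (1 - p) ^ (V.card - F.card) = p ^ A.card * (1 - p) ^ D.card := by
  have key : ∑ F ∈ V.powerset.filter (fun F => A ⊆ F ∧ Disjoint F D),
      p ^ F.card * (1 - p) ^ (V.card - F.card)
      = ∑ G ∈ (V \ (A ∪ D)).powerset, p ^ A.card * (1 - p) ^ D.card *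
          (p ^ G.card * (1 - p) ^ ((V \ (A ∪ D)).card - G.card)) := by
    refine Finset.sum_bij' (fun F _ => F \ A) (fun G _ => A ∪ G) ?_ ?_ ?_ ?_ ?_
    · intro F hF
      simp only [mem_filter, mem_powerset] at hF ⊢
      intro x hx
      simp only [Finset.mem_sdiff, mem_union] at hx ⊢
      refine ⟨hF.1 hx.1, ?_⟩
      rintro (h | h)
      · exact hx.2 h
      · exact (Finset.disjoint_left.mp hF.2.2) hx.1 h
    · intro G hG
      simp only [mem_filter, mem_powerset] at hG ⊢
      refine ⟨union_subset hA (hG.trans sdiff_subset), subset_union_left, ?_⟩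
      rw [disjoint_union_left]
      refine ⟨hAD, ?_⟩
      rw [Finset.disjoint_left]
      intro x hx hxD
      have := hG hx
      simp [hxD] at this
    · intro F hF
      simp only [mem_filter, mem_powerset] at hF
      exact union_sdiff_of_subset hF.2.1
    · intro G hG
      simp only [mem_powerset] at hG
      ext x
      simp only [Finset.mem_sdiff, mem_union]
      constructor
      · rintro ⟨h | h, h'⟩
        · exact absurd h h'
        · exact h
      · intro h
        refine ⟨Or.inr h, ?_⟩
        have := hG h
        simp only [Finset.mem_sdiff, mem_union, not_or] at this
        exact this.2.1
    · intro F hF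
      simp only [mem_filter, mem_powerset] at hF
      have h1 : (F \ A).card + A.card = F.card := card_sdiff_add_card_eq_card hF.2.1
      have h2 : (V \ (A ∪ D)).card + (A ∪ D).card = V.card :=
        card_sdiff_add_card_eq_card (union_subset hA hD)
      have h3 : (A ∪ D).card = A.card + D.card := card_union_of_disjoint hAD
      have h4 : (F ∪ D).card = F.card + D.card := card_union_of_disjoint hF.2.2
      have h5 : (F ∪ D).card ≤ V.card := card_le_card (union_subset hF.1 hD)
      have e1 : V.card - F.card = D.card + ((V \ (A ∪ D)).card - (F \ A).card) := by omega
      have e2 : F.card = A.card + (F \ A).card := by omega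
      rw [e1, pow_add]
      nth_rewrite 1 [e2]
      rw [pow_add]
      ring
  rw [key, ← Finset.mul_sum, Finset.sum_pow_mul_eq_add_pow]
  simp

/-- connectivity of `A` from a root `r` -/
def ConnF {α : Type*} [DecidableEq α] (adj : α → α → Prop) (r : α) (A : Finset α) : Prop :=
  r ∈ A ∧ ∀ B ⊆ A, r ∈ B → B ≠ A → ∃ b ∈ B, ∃ y ∈ A \ B, adj b y

lemma animals {α : Type*} [DecidableEq α] (V : Finset α) (adj : α → α → Prop) (r : α) (Δ : ℕ) (hΔ : 2 ≤ Δ)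
    (hdeg : ∀ A ⊆ V, ((V \ A).filter (fun y => ∃ b ∈ A, adj b y)).card ≤ Δ * A.card) (k : ℕ) :
    ((V.powerset.filter (fun A => ConnF adj r A ∧ A.card = k)).card : ℝ) ≤ (4 * (Δ : ℝ)) ^ k := by
  set S := V.powerset.filter (fun A => ConnF adj r A ∧ A.card = k) with hS
  set p : ℝ := 1 / Δ with hp
  have hΔ' : (2 : ℝ) ≤ Δ := by exact_mod_cast hΔ
  have hp0 : 0 < p := by positivity
  have hp1 : p ≤ 1 / 2 := by
    rw [hp]; exact one_div_le_one_div_of_le (by norm_num) hΔ'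
  let bd : Finset α → Finset α := fun A => (V \ A).filter (fun y => ∃ b ∈ A, adj b y)
  let ev : Finset α → Finset (Finset α) := fun A =>
    V.powerset.filter (fun F => A ⊆ F ∧ Disjoint F (bd A))
  have hquarter : (1 / 4 : ℝ) ≤ (1 - p) ^ Δ := by
    have h1 : ∀ j : ℕ, (1 / 4 : ℝ) ≤ (1 - 1 / ((j : ℝ) + 2)) ^ (j + 2) := by
      intro j
      have hb : (1 : ℝ) - 1 / ((j : ℝ) + 2) = ((j : ℝ) + 1) / (j + 2) := by
        field_simp; ring
      -- use the square root trick: Bernoulli on even/odd split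
      have hj : (0 : ℝ) ≤ j := by positivity
      set x : ℝ := 1 / ((j : ℝ) + 2) with hx
      have hx0 : 0 < x := by positivity
      have hx2 : x ≤ 1 / 2 := by
        rw [hx]; exact one_div_le_one_div_of_le (by norm_num) (by linarith)
      have h4 : (1 / 4 : ℝ) ^ x ≤ 1 - x := by
        -- convexity of  t ↦ (1/4)^t between 0 and 1/2
        have hconv := (convexOn_exp).2 (Set.mem_univ (0 : ℝ))
          (Set.mem_univ (Real.log (1/4) * (1/2))) (show 0 ≤ 1 - 2 * x by linarith)
          (show 0 ≤ 2 * x by linarith) (by ring)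
        have e : Real.exp (Real.log (1/4) * (1/2)) = 1 / 2 := by
          have : (1/4 : ℝ) = (1/2) ^ 2 := by norm_num
          rw [this, Real.log_pow]
          have h : ((2:ℕ):ℝ) * Real.log (1 / 2) * (1 / 2) = Real.log (1/2) := by
            push_cast; ring
          rw [h, Real.exp_log (by norm_num)]
        rw [Real.rpow_def_of_pos (by norm_num)]
        simp only [smul_eq_mul, e, Real.exp_zero] at hconv
        have e2 : (1 - 2 * x) * 0 + 2 * x * (Real.log (1 / 4) * (1 / 2)) = Real.log (1/4) * x := by
          ring
        rw [e2] at hconv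
        linarith
      calc (1 / 4 : ℝ) = ((1 / 4 : ℝ) ^ x) ^ (j + 2) := by
            rw [← Real.rpow_natCast, ← Real.rpow_mul (by norm_num)]
            have : x * ((j + 2 : ℕ) : ℝ) = 1 := by
              rw [hx]; push_cast; field_simp
            rw [this, Real.rpow_one]
        _ ≤ _ := by
            apply pow_le_pow_left₀ (by positivity) h4
    obtain ⟨j, rfl⟩ : ∃ j, Δ = j + 2 := ⟨Δ - 2, by omega⟩
    have := h1 j
    rw [hp]; push_cast; exact this
  have hdisj : (S : Set (Finset α)).PairwiseDisjoint ev := by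
    have hsub : ∀ A A' F : Finset α, A ∈ S → A' ∈ S → F ∈ ev A → F ∈ ev A' → A' ⊆ A := by
      intro A A' F hA hA' hF hF'
      simp only [hS, mem_filter, mem_powerset] at hA hA'
      simp only [ev, mem_filter, mem_powerset] at hF hF'
      by_contra hne
      have hB : A ∩ A' ≠ A' := by
        intro h; apply hne; rw [← h]; exact inter_subset_left
      obtain ⟨b, hb, y, hy, hby⟩ := hA'.2.1.2 (A ∩ A') inter_subset_right
        (mem_inter.mpr ⟨hA.2.1.1, hA'.2.1.1⟩) hB
      simp only [Finset.mem_sdiff, mem_inter] at hb hy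
      have hyA : y ∉ A := fun h => hy.2 ⟨h, hy.1⟩
      apply (Finset.disjoint_left.mp hF.2.2) (hF'.2.1 hy.1)
      simp only [bd, mem_filter, Finset.mem_sdiff]
      exact ⟨⟨hA'.1 hy.1, hyA⟩, b, hb.1, hby⟩
    intro A hA A' hA' hne
    rw [Function.onFun, Finset.disjoint_left]
    intro F hF hF'
    exact hne ((hsub A' A F hA' hA hF' hF).antisymm (hsub A A' F hA hA' hF hF'))
  have hsum : ∑ A ∈ S, ∑ F ∈ ev A, p ^ F.card * (1 - p) ^ (V.card - F.card) ≤ 1 := by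
    rw [← Finset.sum_biUnion hdisj]
    calc _ ≤ ∑ F ∈ V.powerset, p ^ F.card * (1 - p) ^ (V.card - F.card) := by
          apply Finset.sum_le_sum_of_subset_of_nonneg
          · intro F hF
            simp only [mem_biUnion] at hF
            obtain ⟨A, _, hF⟩ := hF
            exact (mem_filter.mp hF).1
          · intro F _ _
            have : 0 ≤ 1 - p := by linarith
            positivity
      _ = 1 := by rw [Finset.sum_pow_mul_eq_add_pow]; simp
  have hterm : ∀ A ∈ S, (1 / (4 * (Δ : ℝ))) ^ k ≤
      ∑ F ∈ ev A, p ^ F.card * (1 - p) ^ (V.card - F.card) := by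
    intro A hA
    have hA' := hA
    simp only [hS, mem_filter, mem_powerset] at hA
    have := wsum_aux V A (bd A) hA.1 ((filter_subset _ _).trans sdiff_subset)
      (by
        rw [Finset.disjoint_left]; intro x hx hx'
        simp only [bd, mem_filter, Finset.mem_sdiff] at hx'
        exact hx'.1.2 hx) p
    rw [this, hA.2.2]
    have hd := hdeg A hA.1
    rw [hA.2.2] at hd
    calc (1 / (4 * (Δ : ℝ))) ^ k = p ^ k * (1 / 4) ^ k := by
          rw [← mul_pow, hp]; congr 1; field_simp
      _ ≤ p ^ k * ((1 - p) ^ Δ) ^ k := by gcongr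
      _ = p ^ k * (1 - p) ^ (Δ * k) := by rw [pow_mul]
      _ ≤ p ^ k * (1 - p) ^ (bd A).card := by
          apply mul_le_mul_of_nonneg_left _ (by positivity)
          exact pow_le_pow_of_le_one (by linarith) (by linarith) hd
  have h := (Finset.sum_le_sum hterm).trans hsum
  rw [Finset.sum_const, nsmul_eq_mul] at h
  have h4 : 0 < 4 * (Δ : ℝ) := by positivity
  rw [one_div, inv_pow, ← div_eq_mul_inv, div_le_one (by positivity)] at h
  exact h

lemma connF_insert {α : Type*} [DecidableEq α] {adj : α → α → Prop} {r : α} {A : Finset α} (h : ConnF adj r A)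
    {u b : α} (hb : b ∈ A) (hbu : adj b u) : ConnF adj r (insert u A) := by
  refine ⟨mem_insert_of_mem h.1, ?_⟩
  intro B hB hr hne
  by_cases hAB : A ⊆ B
  · refine ⟨b, hAB hb, u, ?_, hbu⟩
    simp only [Finset.mem_sdiff, mem_insert, true_or, true_and]
    intro hu
    exact hne (hB.antisymm (insert_subset hu hAB))
  · obtain ⟨b', hb', y, hy, hby⟩ := h.2 (B ∩ A) inter_subset_right (mem_inter.mpr ⟨hr, h.1⟩)
      (fun e => hAB (by rw [← e]; exact inter_subset_left))
    simp only [mem_inter, Finset.mem_sdiff] at hb' hy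
    refine ⟨b', hb'.1, y, ?_, hby⟩
    simp only [Finset.mem_sdiff, mem_insert]
    exact ⟨Or.inr hy.1, fun h' => hy.2 ⟨h', hy.1⟩⟩

lemma connF_union {α : Type*} [DecidableEq α] {adj : α → α → Prop} {r : α} {A A' : Finset α} (h : ConnF adj r A)
    (hA : A ⊆ A') (hn : ∀ u ∈ A' \ A, ∃ b ∈ A, adj b u) : ConnF adj r A' := by
  refine ⟨hA h.1, ?_⟩
  intro B hB hr hne
  by_cases hAB : A ⊆ B
  · obtain ⟨u, hu, huB⟩ : ∃ u ∈ A', u ∉ B := by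
      by_contra hcon
      push Not at hcon
      exact hne (hB.antisymm hcon)
    obtain ⟨b, hb, hbu⟩ := hn u (Finset.mem_sdiff.mpr ⟨hu, fun h => huB (hAB h)⟩)
    exact ⟨b, hAB hb, u, Finset.mem_sdiff.mpr ⟨hu, huB⟩, hbu⟩
  · obtain ⟨b', hb', y, hy, hby⟩ := h.2 (B ∩ A) inter_subset_right (mem_inter.mpr ⟨hr, h.1⟩)
      (fun e => hAB (by rw [← e]; exact inter_subset_left))
    simp only [mem_inter, Finset.mem_sdiff] at hb' hy
    refine ⟨b', hb'.1, y, ?_, hby⟩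
    simp only [Finset.mem_sdiff]
    exact ⟨hA hy.1, fun h' => hy.2 ⟨h', hy.1⟩⟩

/-- outer neighbourhood of `I` in `K` -/
def leafSet {α : Type*} [DecidableEq α] (adj : α → α → Prop) (K I : Finset α) : Finset α :=
  (K \ I).filter (fun x => ∃ b ∈ I, adj b x)

/-- leaves all of whose neighbours are already reached -/
def deadSet {α : Type*} [DecidableEq α] (adj : α → α → Prop) (K I : Finset α) : Finset α :=
  (leafSet adj K I).filter (fun x => ∀ y ∈ K, adj x y → y ∈ I ∪ leafSet adj K I)

lemma mem_leafSet {α : Type*} [DecidableEq α] {adj : α → α → Prop} {K I : Finset α} {x : α} :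
    x ∈ leafSet adj K I ↔ (x ∈ K ∧ x ∉ I) ∧ ∃ b ∈ I, adj b x := by
  simp [leafSet, Finset.mem_sdiff]

lemma reach_mono {α : Type*} [DecidableEq α] {adj : α → α → Prop} {K I I' : Finset α} (h : I ⊆ I') :
    I ∪ leafSet adj K I ⊆ I' ∪ leafSet adj K I' := by
  intro x hx
  rw [mem_union] at hx ⊢
  rcases hx with hx | hx
  · exact Or.inl (h hx)
  · rw [mem_leafSet] at hx
    by_cases hI : x ∈ I'
    · exact Or.inl hI
    · right
      rw [mem_leafSet]
      obtain ⟨b, hb, hbx⟩ := hx.2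
      exact ⟨⟨hx.1.1, hI⟩, b, h hb, hbx⟩

lemma dead_mono {α : Type*} [DecidableEq α] {adj : α → α → Prop} {K I I' : Finset α} (h : I ⊆ I')
    (hd : ∀ x ∈ I', x ∉ deadSet adj K I) : deadSet adj K I ⊆ deadSet adj K I' := by
  intro x hx
  have hx' := hx
  rw [deadSet, mem_filter] at hx ⊢
  refine ⟨?_, fun y hy hxy => reach_mono h (hx.2 y hy hxy)⟩
  have := reach_mono (adj := adj) (K := K) h (mem_union_right _ hx.1)
  rw [mem_union] at this
  rcases this with h1 | h1
  · exact absurd hx' (hd x h1)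
  · exact h1

lemma leaf_lemma {α : Type*} [DecidableEq α] (adj : α → α → Prop) (K : Finset α) (r : α)
    (hsymm : ∀ x y, adj x y → adj y x) (hirr : ∀ x ∈ K, ¬ adj x x)
    (hconn : ConnF adj r K) (hdeg : ∀ x ∈ K, 3 ≤ (K.filter (fun y => adj x y)).card) :
    ∃ I ⊆ K, ConnF adj r I ∧ (∀ x ∈ K \ I, ∃ b ∈ I, adj b x) ∧ K.card ≤ 5 * (K \ I).card := by
  let S := K.powerset.filter (fun I => ConnF adj r I ∧
    I.card ≤ 2 * ((leafSet adj K I).card + (deadSet adj K I).card))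
  have hne : S.Nonempty := by
    refine ⟨{r}, ?_⟩
    simp only [S, mem_filter, mem_powerset, singleton_subset_iff, card_singleton]
    refine ⟨hconn.1, ⟨mem_singleton_self r, ?_⟩, ?_⟩
    · intro B hB hr hne
      exact absurd (hB.antisymm (singleton_subset_iff.mpr hr)) hne
    · have h3 := hdeg r hconn.1
      have : (K.filter (fun y => adj r y)) ⊆ leafSet adj K {r} := by
        intro y hy
        rw [mem_filter] at hy
        rw [mem_leafSet]
        refine ⟨⟨hy.1, ?_⟩, r, mem_singleton_self r, hy.2⟩
        rw [mem_singleton]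
        rintro rfl
        exact hirr _ hy.1 hy.2
      have := card_le_card this
      omega
  obtain ⟨I, hI, hmax⟩ := S.exists_max_image (fun I => I.card) hne
  simp only [S, mem_filter, mem_powerset] at hI hmax
  obtain ⟨hIK, hIc, hIn⟩ := hI
  set L := leafSet adj K I with hL
  set D := deadSet adj K I with hD
  have hLK : L ⊆ K := fun x hx => (mem_leafSet.mp hx).1.1
  have hLI : ∀ x ∈ L, x ∉ I := fun x hx => (mem_leafSet.mp hx).1.2
  have hDL : D ⊆ L := filter_subset _ _
  have hfull : I ∪ L = K := by
    by_contra hcon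
    obtain ⟨u, hu, w, hw, huw⟩ := hconn.2 (I ∪ L) (union_subset hIK hLK)
      (mem_union_left _ hIc.1) hcon
    set O := K \ (I ∪ L) with hO
    have hOm : ∀ x, x ∈ O ↔ x ∈ K ∧ x ∉ I ∧ x ∉ L := by
      intro x; simp [hO, Finset.mem_sdiff, mem_union, not_or]
    have hnoI : ∀ x ∈ O, ∀ b ∈ I, ¬ adj b x := by
      intro x hx b hb hbx
      rw [hOm] at hx
      exact hx.2.2 (mem_leafSet.mpr ⟨⟨hx.1, hx.2.1⟩, b, hb, hbx⟩)
    have hfromL : ∀ u ∈ I ∪ L, ∀ w ∈ O, adj u w → u ∈ L := by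
      intro u hu w hw huw
      rcases mem_union.mp hu with h | h
      · exact absurd huw (hnoI w hw u h)
      · exact h
    have huL : u ∈ L := hfromL u hu w hw huw
    have hnotdead : ∀ u w, w ∈ O → adj u w → u ∉ D := by
      intro u w hw huw hu
      rw [hD, deadSet, mem_filter] at hu
      have := hu.2 w ((hOm w).mp hw).1 huw
      rw [hO, Finset.mem_sdiff] at hw
      exact hw.2 this
    -- general contradiction
    have contra : ∀ I' : Finset α, I ⊆ I' → I' ⊆ K → ConnF adj r I' → I.card < I'.card →
        I'.card ≤ I.card + 2 → (∀ x ∈ I', x ∉ D) →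
        L.card + D.card + 1 ≤ (leafSet adj K I').card + (deadSet adj K I').card → False := by
      intro I' h1 h2 h3 h4 h5 h6 h7
      have := hmax I' ⟨h2, h3, by omega⟩
      omega
    have hDI : ∀ x ∈ I, x ∉ D := fun x hx hxD => hLI x (hDL hxD) hx
    by_cases hc1 : ∃ u ∈ L, 2 ≤ (O.filter (fun w => adj u w)).card
    · obtain ⟨u, huL, h2⟩ := hc1
      obtain ⟨w, hw⟩ : (O.filter (fun w => adj u w)).Nonempty := by
        rw [← card_pos]; omega
      rw [mem_filter] at hw
      obtain ⟨b, hb, hbu⟩ := (mem_leafSet.mp huL).2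
      have hd : ∀ x ∈ insert u I, x ∉ D := by
        intro x hx
        rcases mem_insert.mp hx with rfl | hx
        · exact hnotdead _ w hw.1 hw.2
        · exact hDI x hx
      have hsub : I ⊆ insert u I := subset_insert _ _
      have hcard : (insert u I).card = I.card + 1 := card_insert_of_notMem (hLI u huL)
      refine contra (insert u I) hsub (insert_subset (hLK huL) hIK) (connF_insert hIc hb hbu)
        (by omega) (by omega) hd ?_
      have hDm : D.card ≤ _ := card_le_card (dead_mono hsub hd)
      have hLm : (L.erase u) ∪ (O.filter (fun w => adj u w)) ⊆ leafSet adj K (insert u I) := by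
        intro x hx
        rw [mem_union, mem_erase, mem_filter] at hx
        rw [mem_leafSet]
        rcases hx with hx | hx
        · have := mem_leafSet.mp hx.2
          obtain ⟨b, hb, hbx⟩ := this.2
          exact ⟨⟨this.1.1, by simp [hx.1, this.1.2]⟩, b, hsub hb, hbx⟩
        · have := (hOm x).mp hx.1
          refine ⟨⟨this.1, ?_⟩, u, mem_insert_self _ _, hx.2⟩
          rw [mem_insert]
          rintro (rfl | h)
          · exact this.2.2 huL
          · exact this.2.1 h
      have hdisj : Disjoint (L.erase u) (O.filter (fun w => adj u w)) := by
        rw [Finset.disjoint_left]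
        intro x hx hx'
        exact ((hOm x).mp (mem_filter.mp hx').1).2.2 (mem_of_mem_erase hx)
      have hLc := card_le_card hLm
      rw [card_union_of_disjoint hdisj, card_erase_of_mem huL] at hLc
      have : 0 < L.card := card_pos.mpr ⟨u, huL⟩
      omega
    · push Not at hc1
      have hwO := hw
      have hwK := ((hOm w).mp hw).1
      obtain ⟨b, hb, hbu⟩ := (mem_leafSet.mp huL).2
      have hwu : w ≠ u := by rintro rfl; exact ((hOm w).mp hw).2.2 huL
      by_cases hc2 : 2 ≤ (O.filter (fun y => adj w y)).card
      · have hd : ∀ x ∈ insert w (insert u I), x ∉ D := by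
          intro x hx
          rcases mem_insert.mp hx with rfl | hx
          · exact fun h => ((hOm x).mp hw).2.2 (hDL h)
          rcases mem_insert.mp hx with rfl | hx
          · exact hnotdead _ w hw huw
          · exact hDI x hx
        have hsub : I ⊆ insert w (insert u I) := (subset_insert _ _).trans (subset_insert _ _)
        have hcard : (insert u I).card = I.card + 1 := card_insert_of_notMem (hLI u huL)
        have hcard2 : (insert w (insert u I)).card = (insert u I).card + 1 := by
          apply card_insert_of_notMem
          rw [mem_insert]
          rintro (h | h)
          · exact hwu h
          · exact ((hOm w).mp hw).2.1 h
        refine contra (insert w (insert u I)) hsub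
          (insert_subset hwK (insert_subset (hLK huL) hIK))
          (connF_insert (connF_insert hIc hb hbu) (mem_insert_self _ _) huw)
          (by omega) (by omega) hd ?_
        have hDm : D.card ≤ _ := card_le_card (dead_mono hsub hd)
        have hLm : (L.erase u) ∪ (O.filter (fun y => adj w y)) ⊆
            leafSet adj K (insert w (insert u I)) := by
          intro x hx
          rw [mem_union, mem_erase, mem_filter] at hx
          rw [mem_leafSet]
          rcases hx with hx | hx
          · have := mem_leafSet.mp hx.2
            obtain ⟨b, hb, hbx⟩ := this.2
            refine ⟨⟨this.1.1, ?_⟩, b, hsub hb, hbx⟩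
            simp only [mem_insert, not_or]
            refine ⟨?_, hx.1, this.1.2⟩
            rintro rfl
            exact ((hOm x).mp hw).2.2 hx.2
          · have := (hOm x).mp hx.1
            refine ⟨⟨this.1, ?_⟩, w, mem_insert_self _ _, hx.2⟩
            simp only [mem_insert, not_or]
            refine ⟨?_, ?_, this.2.1⟩
            · rintro rfl; exact hirr _ hwK hx.2
            · rintro rfl; exact this.2.2 huL
        have hdisj : Disjoint (L.erase u) (O.filter (fun y => adj w y)) := by
          rw [Finset.disjoint_left]
          intro x hx hx'
          exact ((hOm x).mp (mem_filter.mp hx').1).2.2 (mem_of_mem_erase hx)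
        have hLc := card_le_card hLm
        rw [card_union_of_disjoint hdisj, card_erase_of_mem huL] at hLc
        have : 0 < L.card := card_pos.mpr ⟨u, huL⟩
        omega
      · push Not at hc2
        -- another neighbour of w in L
        obtain ⟨u', hu'L, hu'u, hwu'⟩ : ∃ u' ∈ L, u' ≠ u ∧ adj w u' := by
          by_contra hcon2
          push Not at hcon2
          have hsub : K.filter (fun y => adj w y) ⊆ insert u (O.filter (fun y => adj w y)) := by
            intro y hy
            rw [mem_filter] at hy
            rw [mem_insert, mem_filter]
            by_cases hyu : y = u
            · exact Or.inl hyu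
            · right
              refine ⟨?_, hy.2⟩
              rw [hOm]
              refine ⟨hy.1, ?_, fun h => hcon2 y h hyu hy.2⟩
              intro h
              exact hnoI w hw y h (hsymm _ _ hy.2)
          have h1 := card_le_card hsub
          have h2 := card_insert_le u (O.filter (fun y => adj w y))
          have h3 := hdeg w hwK
          omega
        have hsub : I ⊆ insert u I := subset_insert _ _
        have hd : ∀ x ∈ insert u I, x ∉ D := by
          intro x hx
          rcases mem_insert.mp hx with rfl | hx
          · exact hnotdead _ w hw huw
          · exact hDI x hx
        have hcard : (insert u I).card = I.card + 1 := card_insert_of_notMem (hLI u huL)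
        refine contra (insert u I) hsub (insert_subset (hLK huL) hIK) (connF_insert hIc hb hbu)
          (by omega) (by omega) hd ?_
        have hLm : insert w (L.erase u) ⊆ leafSet adj K (insert u I) := by
          intro x hx
          rw [mem_insert, mem_erase] at hx
          rw [mem_leafSet]
          rcases hx with rfl | hx
          · refine ⟨⟨hwK, ?_⟩, u, mem_insert_self _ _, huw⟩
            rw [mem_insert]
            rintro (h | h)
            · exact hwu h
            · exact ((hOm x).mp hw).2.1 h
          · have := mem_leafSet.mp hx.2
            obtain ⟨b, hb, hbx⟩ := this.2
            exact ⟨⟨this.1.1, by simp [hx.1, this.1.2]⟩, b, hsub hb, hbx⟩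
        have hLc := card_le_card hLm
        rw [card_insert_of_notMem (fun h => ((hOm w).mp hw).2.2 (mem_of_mem_erase h)),
          card_erase_of_mem huL] at hLc
        have hDm : insert u' D ⊆ deadSet adj K (insert u I) := by
          apply insert_subset _ (dead_mono hsub hd)
          rw [deadSet, mem_filter]
          refine ⟨hLm (mem_insert_of_mem (mem_erase.mpr ⟨hu'u, hu'L⟩)), ?_⟩
          intro y hy hu'y
          by_cases hyO : y ∈ O
          · have hyw : y = w := by
              by_contra hyw
              have h1 := hc1 u' hu'L
              have h2 : ({y, w} : Finset α) ⊆ O.filter (fun w => adj u' w) := by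
                intro z hz
                rw [mem_insert, mem_singleton] at hz
                rw [mem_filter]
                rcases hz with rfl | rfl
                · exact ⟨hyO, hu'y⟩
                · exact ⟨hw, hsymm _ _ hwu'⟩
              have h3 := card_le_card h2
              rw [card_pair hyw] at h3
              omega
            rw [hyw]
            exact mem_union_right _ (hLm (mem_insert_self _ _))
          · apply reach_mono hsub
            by_contra h
            exact hyO (by rw [hO, Finset.mem_sdiff]; exact ⟨hy, h⟩)
        have hDc := card_le_card hDm
        rw [card_insert_of_notMem (hnotdead u' w hw (hsymm _ _ hwu'))] at hDc
        have : 0 < L.card := card_pos.mpr ⟨u, huL⟩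
        omega
  refine ⟨I, hIK, hIc, ?_, ?_⟩
  · intro x hx
    rw [Finset.mem_sdiff] at hx
    have : x ∈ I ∪ L := by rw [hfull]; exact hx.1
    rcases mem_union.mp this with h | h
    · exact absurd h hx.2
    · exact (mem_leafSet.mp h).2
  · have hKI : K \ I = L := by
      rw [← hfull, union_sdiff_left]
      exact sdiff_eq_self_of_disjoint (Finset.disjoint_left.mpr hLI)
    have h1 : (K \ I).card + I.card = K.card := card_sdiff_add_card_eq_card hIK
    have h2 := card_le_card hDL
    rw [hKI] at h1 ⊢
    omega

/-- two faces share a facet -/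
def faceAdj (n d : ℕ) (f g : Finset (Fin n)) : Prop := (f ∩ g).card = d

/-- every facet is in at least two faces -/
def IsCore (n d : ℕ) (K : Finset (Finset (Fin n))) : Prop :=
  K ⊆ allFaces n d ∧ K.Nonempty ∧ ∀ f ∈ K, ∀ a ∈ f, ∃ g ∈ K, g ≠ f ∧ f.erase a ⊆ g

/-- inclusion minimal core -/
def MinCore (n d : ℕ) (K : Finset (Finset (Fin n))) : Prop :=
  IsCore n d K ∧ ∀ K' ⊆ K, IsCore n d K' → K' = K

lemma mem_allFaces {n d : ℕ} {f : Finset (Fin n)} : f ∈ allFaces n d ↔ f.card = d + 1 := by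
  simp [allFaces]

lemma facet_facts {n d : ℕ} {f g : Finset (Fin n)} (hf : f.card = d + 1) (hg : g.card = d + 1)
    (hne : g ≠ f) {a : Fin n} (ha : a ∈ f) (hs : f.erase a ⊆ g) :
    a ∉ g ∧ f ∩ g = f.erase a ∧ ∃ b, b ∉ f ∧ g = insert b (f.erase a) := by
  have hag : a ∉ g := by
    intro hag
    apply hne
    symm
    apply eq_of_subset_of_card_le _ (by omega)
    intro x hx
    by_cases hxa : x = a
    · rw [hxa]; exact hag
    · exact hs (mem_erase.mpr ⟨hxa, hx⟩)
  refine ⟨hag, ?_, ?_⟩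
  · ext x
    simp only [mem_inter, mem_erase]
    constructor
    · rintro ⟨h1, h2⟩
      exact ⟨fun h => hag (h ▸ h2), h1⟩
    · rintro ⟨h1, h2⟩
      exact ⟨h2, hs (mem_erase.mpr ⟨h1, h2⟩)⟩
  · have hc : (g \ f.erase a).card = 1 := by
      rw [card_sdiff_of_subset hs, card_erase_of_mem ha]; omega
    obtain ⟨b, hb⟩ := card_eq_one.mp hc
    have hbm : b ∈ g \ f.erase a := by rw [hb]; exact mem_singleton_self b
    rw [Finset.mem_sdiff] at hbm
    refine ⟨b, ?_, ?_⟩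
    · intro hbf
      apply hbm.2
      rw [mem_erase]
      exact ⟨fun h => hag (h ▸ hbm.1), hbf⟩
    · rw [insert_eq, ← hb, sdiff_union_of_subset hs]

lemma core_adj {n d : ℕ} {f g : Finset (Fin n)} (hf : f.card = d + 1) (hg : g.card = d + 1)
    (hne : g ≠ f) {a : Fin n} (ha : a ∈ f) (hs : f.erase a ⊆ g) : faceAdj n d f g := by
  rw [faceAdj, (facet_facts hf hg hne ha hs).2.1, card_erase_of_mem ha]; omega

lemma faceAdj_symm {n d : ℕ} (f g : Finset (Fin n)) (h : faceAdj n d f g) : faceAdj n d g f := by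
  rw [faceAdj, inter_comm]; exact h

lemma minCore_conn {n d : ℕ} {K : Finset (Finset (Fin n))} (hK : MinCore n d K)
    {r : Finset (Fin n)} (hr : r ∈ K) : ConnF (faceAdj n d) r K := by
  refine ⟨hr, ?_⟩
  intro B hB hrB hne
  by_contra hcon
  push Not at hcon
  apply hne
  apply hK.2 B hB
  refine ⟨hB.trans hK.1.1, ⟨r, hrB⟩, ?_⟩
  intro f hf a ha
  obtain ⟨g, hg, hgf, hs⟩ := hK.1.2.2 f (hB hf) a ha
  refine ⟨g, ?_, hgf, hs⟩
  by_contra hgB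
  exact hcon f hf g (Finset.mem_sdiff.mpr ⟨hg, hgB⟩)
    (core_adj (mem_allFaces.mp (hK.1.1 (hB hf))) (mem_allFaces.mp (hK.1.1 hg)) hgf ha hs)

lemma core_nbrs {n d : ℕ} {K : Finset (Finset (Fin n))} (hK : IsCore n d K)
    {f : Finset (Fin n)} (hf : f ∈ K) : d + 1 ≤ (K.filter (fun g => faceAdj n d f g)).card := by
  have hex := hK.2.2 f hf
  choose! G hG using hex
  have hfc := mem_allFaces.mp (hK.1 hf)
  rw [← hfc]
  apply card_le_card_of_injOn G
  · intro a ha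
    have := hG a ha
    rw [mem_coe, mem_filter]
    exact ⟨this.1, core_adj hfc (mem_allFaces.mp (hK.1 this.1)) this.2.1 ha this.2.2⟩
  · intro a ha b hb hab
    by_contra hne
    have h1 := hG a ha
    have h2 := hG b hb
    have h3 := (facet_facts hfc (mem_allFaces.mp (hK.1 h2.1)) h2.2.1 hb h2.2.2).1
    have hab' : G a = G b := hab
    apply h3
    rw [← hab']
    exact h1.2.2 (mem_erase.mpr ⟨fun h => hne h.symm, hb⟩)

lemma core_decomp {n d : ℕ} (hd : 2 ≤ d) {K : Finset (Finset (Fin n))} (hK : MinCore n d K)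
    {r : Finset (Fin n)} (hr : r ∈ K) :
    ∃ K1 ⊆ K, ConnF (faceAdj n d) r K1 ∧ K.card ≤ 5 * (d + 2) * (K \ K1).card ∧
      ∀ f ∈ K \ K1, ∀ a ∈ f, f.erase a ∈ Finset.shadow K1 := by
  have hcard : ∀ f ∈ K, f.card = d + 1 := fun f hf => mem_allFaces.mp (hK.1.1 hf)
  obtain ⟨I, hIK, hIc, hnb, hI5⟩ := leaf_lemma (faceAdj n d) K r faceAdj_symm
    (by
      intro x hx h
      rw [faceAdj, inter_self, hcard x hx] at h
      omega) (minCore_conn hK hr)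
    (fun x hx => (by omega : 3 ≤ d + 1).trans (core_nbrs hK.1 hx))
  set L := K \ I with hL
  -- minimal cover
  let S := L.powerset.filter (fun C => ∀ f ∈ K, ∀ a ∈ f, ∃ g ∈ I ∪ C, f.erase a ⊆ g)
  have hS : S.Nonempty := by
    refine ⟨L, ?_⟩
    simp only [S, mem_filter, mem_powerset, Subset.refl, true_and]
    intro f hf a _
    refine ⟨f, ?_, erase_subset _ _⟩
    rw [hL, union_sdiff_of_subset hIK]; exact hf
  obtain ⟨C, hC, hmin⟩ := S.exists_min_image (fun C => C.card) hS
  simp only [S, mem_filter, mem_powerset] at hC hmin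
  have hLK : L ⊆ K := sdiff_subset
  have hK2 : K \ (I ∪ C) = L \ C := by rw [hL, sdiff_sdiff_left]; rfl
  refine ⟨I ∪ C, union_subset hIK (hC.1.trans hLK), ?_, ?_, ?_⟩
  · apply connF_union hIc subset_union_left
    intro u hu
    rw [Finset.mem_sdiff, mem_union] at hu
    apply hnb u
    rcases hu.1 with h | h
    · exact absurd h hu.2
    · exact hC.1 h
  · rw [hK2]
    -- private facets
    have hpriv : ∀ f ∈ C, ∃ g ∈ L \ C, ∃ t : Finset (Fin n), t ⊆ f ∧ t.card = d ∧ t ⊆ g ∧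
        ∀ f' ∈ C, t ⊆ f' → f' = f := by
      intro f hf
      have hfK := hLK (hC.1 hf)
      have hnot : ¬ ∀ f' ∈ K, ∀ a ∈ f', ∃ g ∈ I ∪ C.erase f, f'.erase a ⊆ g := by
        intro hcov
        have := hmin (C.erase f) ⟨(erase_subset _ _).trans hC.1, hcov⟩
        rw [card_erase_of_mem hf] at this
        have : 0 < C.card := card_pos.mpr ⟨f, hf⟩
        omega
      push Not at hnot
      obtain ⟨f', hf', a', ha', hno⟩ := hnot
      obtain ⟨g0, hg0, hs0⟩ := hC.2 f' hf' a' ha'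
      have hg0f : g0 = f := by
        by_contra hne
        apply hno g0 _ hs0
        rw [mem_union] at hg0 ⊢
        rcases hg0 with h | h
        · exact Or.inl h
        · exact Or.inr (mem_erase.mpr ⟨hne, h⟩)
      subst hg0f
      -- the facet is  g0.erase a
      have hcc : (g0 \ f'.erase a').card = 1 := by
        rw [card_sdiff_of_subset hs0, card_erase_of_mem ha', hcard _ hf', hcard _ hfK]; omega
      obtain ⟨a, ha⟩ := card_eq_one.mp hcc
      have hfac : g0.erase a = f'.erase a' := by
        rw [erase_eq, ← ha, Finset.sdiff_sdiff_eq_self hs0]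
      have hag : a ∈ g0 := by
        have : a ∈ g0 \ f'.erase a' := by rw [ha]; exact mem_singleton_self a
        exact (Finset.mem_sdiff.mp this).1
      rw [← hfac] at hno
      obtain ⟨g, hg, hgne, hgs⟩ := hK.1.2.2 g0 hfK a hag
      refine ⟨g, ?_, g0.erase a, erase_subset _ _,
        by rw [card_erase_of_mem hag, hcard _ hfK]; omega, hgs, ?_⟩
      · rw [Finset.mem_sdiff, hL, Finset.mem_sdiff]
        refine ⟨⟨hg, ?_⟩, ?_⟩
        · intro h; exact hno g (mem_union_left _ h) hgs
        · intro h; exact hno g (mem_union_right _ (mem_erase.mpr ⟨hgne, h⟩)) hgs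
      · intro f'' hf'' hs
        by_contra hne
        exact hno f'' (mem_union_right _ (mem_erase.mpr ⟨hne, hf''⟩)) hs
    choose! G hG A hA using hpriv
    have hfib : ∀ g ∈ L \ C, (C.filter (fun f => G f = g)).card ≤ d + 1 := by
      intro g hg
      have hgK : g ∈ K := hLK (Finset.mem_sdiff.mp hg).1
      have hgc := hcard g hgK
      have : (C.filter (fun f => G f = g)).card ≤ (g.powersetCard d).card := by
        apply card_le_card_of_injOn A
        · intro f hf
          rw [mem_coe, mem_filter] at hf
          have h := hA f hf.1
          rw [hf.2] at h
          rw [mem_coe, mem_powersetCard]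
          exact ⟨h.2.2.1, h.2.1⟩
        · intro f hf f' hf' he
          rw [mem_coe, mem_filter] at hf hf'
          have h := (hA f hf.1).2.2.2 f' hf'.1 (by rw [he]; exact (hA f' hf'.1).1)
          exact h.symm
      rw [card_powersetCard, hgc] at this
      simpa [Nat.choose_succ_self_right] using this
    have hCle : C.card ≤ (d + 1) * (L \ C).card := by
      have := card_le_mul_card_image_of_maps_to (s := C) (t := L \ C) (f := G)
        (fun f hf => hG f hf) (d + 1) hfib
      exact this
    have h1 : (L \ C).card + C.card = L.card := card_sdiff_add_card_eq_card hC.1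
    calc K.card ≤ 5 * L.card := hI5
      _ ≤ 5 * ((d + 2) * (L \ C).card) := by
          apply Nat.mul_le_mul_left
          rw [← h1]; nlinarith
      _ = _ := by ring
  · intro f hf a ha
    rw [Finset.mem_sdiff] at hf
    obtain ⟨g, hg, hs⟩ := hC.2 f hf.1 a ha
    rw [mem_shadow_iff_exists_mem_card_add_one]
    refine ⟨g, hg, hs, ?_⟩
    have hgK : g ∈ K := (union_subset hIK (hC.1.trans hLK)) hg
    rw [hcard g hgK, card_erase_of_mem ha, hcard f hf.1]; omega

lemma shadow_card_le {n d : ℕ} {K : Finset (Finset (Fin n))} (hK : ∀ f ∈ K, f.card = d + 1) :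
    (Finset.shadow K).card ≤ (d + 1) * K.card := by
  have : Finset.shadow K ⊆ K.biUnion (fun f => f.powersetCard d) := by
    intro s hs
    rw [mem_shadow_iff_exists_mem_card_add_one] at hs
    obtain ⟨f, hf, hsf, hc⟩ := hs
    rw [mem_biUnion]
    exact ⟨f, hf, mem_powersetCard.mpr ⟨hsf, by have := hK f hf; omega⟩⟩
  refine (card_le_card this).trans ?_
  rw [mul_comm]
  apply card_biUnion_le_card_mul
  intro f hf
  rw [card_powersetCard, hK f hf, Nat.choose_succ_self_right]

/-- candidates: faces with all facets in the shadow of `K` -/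
def cand (n d : ℕ) (K : Finset (Finset (Fin n))) : Finset (Finset (Fin n)) :=
  (allFaces n d).filter (fun f => ∀ a ∈ f, f.erase a ∈ Finset.shadow K)

lemma cand_card {n d : ℕ} {K : Finset (Finset (Fin n))} (hK : ∀ f ∈ K, f.card = d + 1)
    (k0 : ℕ) (hd : 1 ≤ d) (hk0 : k0 ≤ n) (hk : (d + 1) * K.card < k0.choose d) :
    (cand n d K).card ≤ K.card * k0 := by
  set A := cand n d K with hA
  have hsh : Finset.shadow A ⊆ Finset.shadow K := by
    intro s hs
    rw [mem_shadow_iff] at hs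
    obtain ⟨f, hf, a, ha, rfl⟩ := hs
    exact (mem_filter.mp hf).2 a ha
  have hshc : (Finset.shadow A).card ≤ (d + 1) * K.card :=
    (card_le_card hsh).trans (shadow_card_le hK)
  have hex : ∃ k : ℕ, (Finset.shadow A).card < k.choose d := ⟨k0, by omega⟩
  let k := Nat.find hex
  have hks : (Finset.shadow A).card < k.choose d := Nat.find_spec hex
  have hkk0 : k ≤ k0 := Nat.find_min' hex (by omega)
  have hkd : d ≤ k := by
    by_contra h
    rw [Nat.choose_eq_zero_of_lt (by omega)] at hks
    omega
  have hsized : (A : Set (Finset (Fin n))).Sized (d + 1) := by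
    intro f hf
    exact mem_allFaces.mp (mem_filter.mp hf).1
  have hAk : A.card ≤ k.choose (d + 1) := by
    by_contra hcon
    push Not at hcon
    rcases Nat.lt_or_ge k (d + 1) with h | h
    · -- k = d, shadow empty
      have hkd' : k = d := by omega
      rw [hkd', Nat.choose_self] at hks
      have hemp : Finset.shadow A = ∅ := card_eq_zero.mp (by omega)
      have hpos : 0 < A.card := by omega
      obtain ⟨f, hf⟩ := card_pos.mp hpos
      have hfc : f.card = d + 1 := hsized hf
      obtain ⟨a, ha⟩ : f.Nonempty := card_pos.mp (by omega)
      have : f.erase a ∈ Finset.shadow A := mem_shadow_iff.mpr ⟨f, hf, a, ha, rfl⟩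
      rw [hemp] at this
      simp at this
    · have := kruskal_katona_lovasz_form (i := 1) (r := d + 1) (k := k) (n := n) (𝒜 := A)
        (by omega) h (by omega) hsized hcon.le
      simp at this
      omega
  rcases Nat.eq_or_lt_of_le hkd with h | h
  · rw [← h, Nat.choose_succ_self] at hAk
    omega
  · obtain ⟨j, hj⟩ : ∃ j, k = j + 1 := ⟨k - 1, by omega⟩
    have hjs : j.choose d ≤ (Finset.shadow A).card := by
      by_contra hcon
      push Not at hcon
      have := Nat.find_min' hex hcon
      omega
    have h1 : (j + 1).choose (d + 1) * (d + 1) = (j + 1) * j.choose d :=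
      (Nat.add_one_mul_choose_eq j d).symm
    rw [hj] at hAk hkk0
    have : A.card * (d + 1) ≤ K.card * k0 * (d + 1) := by
      calc A.card * (d + 1) ≤ (j + 1).choose (d + 1) * (d + 1) := Nat.mul_le_mul_right _ hAk
        _ = (j + 1) * j.choose d := h1
        _ ≤ k0 * ((d + 1) * K.card) := Nat.mul_le_mul hkk0 (hjs.trans hshc)
        _ = _ := by ring
    exact Nat.le_of_mul_le_mul_right this (by omega)

/-- the star of a vertex -/
def starOf {n : ℕ} (K : Finset (Finset (Fin n))) (x : Fin n) : Finset (Finset (Fin n)) :=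
  K.filter (fun f => x ∈ f)

lemma core_nb {n d : ℕ} {K : Finset (Finset (Fin n))} (hK : IsCore n d K)
    {f : Finset (Fin n)} (hf : f ∈ K) (a : Fin n) (ha : a ∈ f) :
    ∃ b, b ∉ f ∧ insert b (f.erase a) ∈ K := by
  obtain ⟨g, hg, hne, hs⟩ := hK.2.2 f hf a ha
  obtain ⟨_, _, b, hb, rfl⟩ := facet_facts (mem_allFaces.mp (hK.1 hf)) (mem_allFaces.mp (hK.1 hg))
    hne ha hs
  exact ⟨b, hb, hg⟩

lemma star_struct {n d : ℕ} {K : Finset (Finset (Fin n))} (hK : IsCore n d K)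
    {f : Finset (Fin n)} (hf : f ∈ K) {x : Fin n} (hx : x ∈ f) (b : Fin n → Fin n)
    (hb : ∀ a ∈ f, b a ∉ f ∧ insert (b a) (f.erase a) ∈ K) :
    insert f ((f.erase x).image (fun a => insert (b a) (f.erase a))) ⊆ starOf K x ∧
    (insert f ((f.erase x).image (fun a => insert (b a) (f.erase a)))).card = d + 1 := by
  constructor
  · intro g hg
    rw [mem_insert, mem_image] at hg
    rw [starOf, mem_filter]
    rcases hg with rfl | ⟨a, ha, rfl⟩
    · exact ⟨hf, hx⟩
    · rw [mem_erase] at ha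
      exact ⟨(hb a ha.2).2, by simp [hx, Ne.symm ha.1]⟩
  · rw [card_insert_of_notMem, card_image_of_injOn, card_erase_of_mem hx, mem_allFaces.mp (hK.1 hf)]
    · omega
    · intro a ha a' ha' he
      rw [mem_coe, mem_erase] at ha ha'
      by_contra hne
      have h1 : a ∈ insert (b a') (f.erase a') := by simp [hne, ha.2]
      have he' : insert (b a) (f.erase a) = insert (b a') (f.erase a') := he
      rw [← he'] at h1
      rw [mem_insert] at h1
      rcases h1 with h1 | h1
      · exact (hb a ha.2).1 (h1 ▸ ha.2)
      · simp at h1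
    · rw [mem_image]
      rintro ⟨a, ha, he⟩
      rw [mem_erase] at ha
      apply (hb a ha.2).1
      rw [← he]
      have : b a ∈ insert (b a) (f.erase a) := mem_insert_self _ _
      rw [he] at this
      exact he ▸ mem_insert_self _ _

lemma deg_ge {n d : ℕ} {K : Finset (Finset (Fin n))} (hK : IsCore n d K)
    {f : Finset (Fin n)} (hf : f ∈ K) {x : Fin n} (hx : x ∈ f) : d + 1 ≤ (starOf K x).card := by
  haveI : Nonempty (Fin n) := ⟨x⟩
  have := core_nb hK hf
  choose! b hb using this
  obtain ⟨h1, h2⟩ := star_struct hK hf hx b hb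
  rw [← h2]
  exact card_le_card h1

lemma small_star {n d : ℕ} (hd : 2 ≤ d) {K : Finset (Finset (Fin n))} (hK : IsCore n d K)
    {f : Finset (Fin n)} (hf : f ∈ K) {x : Fin n} (hx : x ∈ f) (hdeg : (starOf K x).card = d + 1) :
    ∃ W : Finset (Fin n), W.card = d + 2 ∧ (∀ g ∈ K, x ∈ g → g ⊆ W) ∧
      (∀ g, g ⊆ W → g.card = d + 1 → x ∈ g → g ∈ K) := by
  haveI : Nonempty (Fin n) := ⟨x⟩
  have := core_nb hK hf
  choose! b hb using this
  obtain ⟨h1, h2⟩ := star_struct hK hf hx b hb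
  have hfc := mem_allFaces.mp (hK.1 hf)
  have hst : starOf K x = insert f ((f.erase x).image (fun a => insert (b a) (f.erase a))) :=
    (eq_of_subset_of_card_le h1 (by omega)).symm
  have hbeq : ∀ a ∈ f, ∀ a' ∈ f, a ≠ x → a' ≠ x → a ≠ a' → b a = b a' := by
    intro a ha a' ha' hax hax' hne
    have hGa := (hb a ha).2
    have hmem : a' ∈ insert (b a) (f.erase a) := by simp [ha', Ne.symm hne]
    obtain ⟨h, hh, hhne, hs⟩ := hK.2.2 _ hGa a' hmem
    have hba' : b a ≠ a' := fun h => (hb a ha).1 (h ▸ ha')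
    have hxh : x ∈ h := hs (by simp [hx, Ne.symm hax, Ne.symm hax'])
    have hbh : b a ∈ h := hs (by simp [hba'])
    have hhs : h ∈ starOf K x := mem_filter.mpr ⟨hh, hxh⟩
    rw [hst, mem_insert, mem_image] at hhs
    rcases hhs with rfl | ⟨a2, ha2, rfl⟩
    · exact absurd hbh (hb a ha).1
    · rw [mem_erase] at ha2
      have ha2no : a2 ∉ insert (b a2) (f.erase a2) := by
        rw [mem_insert]
        rintro (h | h)
        · exact (hb a2 ha2.2).1 (h ▸ ha2.2)
        · simp at h
      by_cases e1 : a2 = a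
      · subst e1; exact absurd rfl hhne
      by_cases e2 : a2 = a'
      · subst e2
        rw [mem_insert] at hbh
        rcases hbh with h | h
        · exact h
        · exact absurd (mem_of_mem_erase h) (hb a ha).1
      · exfalso
        apply ha2no
        apply hs
        simp [e1, e2, ha2.2]
  obtain ⟨a0, ha0⟩ : (f.erase x).Nonempty := by
    rw [← card_pos, card_erase_of_mem hx]; omega
  rw [mem_erase] at ha0
  have hall : ∀ a ∈ f, a ≠ x → b a = b a0 := by
    intro a ha hax
    by_cases h : a = a0
    · rw [h]
    · exact hbeq a ha a0 ha0.2 hax ha0.1 h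
  have hb0 := (hb a0 ha0.2).1
  refine ⟨insert (b a0) f, by rw [card_insert_of_notMem hb0, hfc], ?_, ?_⟩
  · intro g hg hxg
    have : g ∈ starOf K x := mem_filter.mpr ⟨hg, hxg⟩
    rw [hst, mem_insert, mem_image] at this
    rcases this with rfl | ⟨a, ha, rfl⟩
    · exact subset_insert _ _
    · rw [mem_erase] at ha
      rw [hall a ha.2 ha.1]
      exact insert_subset_insert _ (erase_subset _ _)
  · intro g hg hgc hxg
    have hc : (insert (b a0) f \ g).card = 1 := by
      rw [card_sdiff_of_subset hg, card_insert_of_notMem hb0, hfc, hgc]; omega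
    obtain ⟨a, ha⟩ := card_eq_one.mp hc
    have hge : g = (insert (b a0) f).erase a := by
      rw [erase_eq, ← ha, Finset.sdiff_sdiff_eq_self hg]
    have ham : a ∈ insert (b a0) f \ g := by rw [ha]; exact mem_singleton_self a
    rw [Finset.mem_sdiff, mem_insert] at ham
    have hax : a ≠ x := fun h => ham.2 (h ▸ hxg)
    rcases ham.1 with h | h
    · rw [hge, h, erase_insert hb0]; exact hf
    · have hab : a ≠ b a0 := fun h' => hb0 (h' ▸ h)
      rw [hge, erase_insert_of_ne hab.symm, ← hall a h hax]
      exact (hb a h).2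

lemma simplex_core {n d : ℕ} {W : Finset (Fin n)} (hW : W.card = d + 2) :
    IsCore n d (W.powersetCard (d + 1)) := by
  refine ⟨?_, ?_, ?_⟩
  · intro f hf; exact mem_allFaces.mpr (mem_powersetCard.mp hf).2
  · rw [powersetCard_nonempty]; omega
  · intro f hf a ha
    rw [mem_powersetCard] at hf
    refine ⟨W.erase a, ?_, ?_, erase_subset_erase _ hf.1⟩
    · rw [mem_powersetCard, card_erase_of_mem (hf.1 ha)]
      exact ⟨erase_subset _ _, by omega⟩
    · intro h
      rw [← h] at ha
      simp at ha

lemma small_unique {n d : ℕ} (hd : 2 ≤ d) {K : Finset (Finset (Fin n))} (hK : MinCore n d K)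
    (hns : ¬ ∃ W : Finset (Fin n), W.card = d + 2 ∧ K = W.powersetCard (d + 1))
    {f : Finset (Fin n)} (hf : f ∈ K) {x u : Fin n} (hx : x ∈ f) (hu : u ∈ f)
    (hxd : (starOf K x).card = d + 1) (hud : (starOf K u).card = d + 1) : x = u := by
  by_contra hne
  obtain ⟨W, hW, hW1, hW2⟩ := small_star hd hK.1 hf hx hxd
  obtain ⟨W', hW', hW1', hW2'⟩ := small_star hd hK.1 hf hu hud
  have hfc := mem_allFaces.mp (hK.1.1 hf)
  obtain ⟨a, ha⟩ : ((f.erase x).erase u).Nonempty := by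
    rw [← card_pos, card_erase_of_mem (mem_erase.mpr ⟨Ne.symm hne, hu⟩), card_erase_of_mem hx]
    omega
  rw [mem_erase, mem_erase] at ha
  have hfW := hW1 f hf hx
  have hfW' := hW1' f hf hu
  have hKa : W.erase a ∈ K := by
    apply hW2 _ (erase_subset _ _)
    · rw [card_erase_of_mem (hfW ha.2.2)]; omega
    · exact mem_erase.mpr ⟨Ne.symm ha.2.1, hfW hx⟩
  have hsub := hW1' _ hKa (mem_erase.mpr ⟨Ne.symm ha.1, hfW hu⟩)
  have hWW : W = W' := by
    apply eq_of_subset_of_card_le _ (by omega)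
    intro y hy
    by_cases h : y = a
    · rw [h]; exact hfW' ha.2.2
    · exact hsub (mem_erase.mpr ⟨h, hy⟩)
  subst hWW
  apply hns
  refine ⟨W, hW, ?_⟩
  symm
  apply hK.2 _ _ (simplex_core hW)
  intro g hg
  rw [mem_powersetCard] at hg
  by_cases hxg : x ∈ g
  · exact hW2 g hg.1 hg.2 hxg
  · apply hW2' g hg.1 hg.2
    by_contra hug
    have : g ⊆ (W.erase x).erase u := by
      intro y hy
      rw [mem_erase, mem_erase]
      exact ⟨fun h => hug (h ▸ hy), fun h => hxg (h ▸ hy), hg.1 hy⟩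
    have := card_le_card this
    rw [card_erase_of_mem (mem_erase.mpr ⟨Ne.symm hne, hfW hu⟩), card_erase_of_mem (hfW hx)] at this
    omega

lemma double_count {n : ℕ} (K : Finset (Finset (Fin n))) (S : Finset (Fin n)) :
    ∑ x ∈ S, (starOf K x).card = ∑ f ∈ K, (S.filter (fun x => x ∈ f)).card :=
  Finset.sum_card_bipartiteAbove_eq_sum_card_bipartiteBelow (fun x f => x ∈ f)

lemma vertex_count {n d : ℕ} (hd : 2 ≤ d) {K : Finset (Finset (Fin n))} (hK : MinCore n d K)
    (hns : ¬ ∃ W : Finset (Fin n), W.card = d + 2 ∧ K = W.powersetCard (d + 1)) :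
    (d + 1) * (d + 2) * (K.biUnion id).card + d * K.card ≤ (d + 1) * (d + 2) * K.card := by
  set V := K.biUnion id with hV
  set A := V.filter (fun x => (starOf K x).card = d + 1) with hA
  set B := V.filter (fun x => ¬ (starOf K x).card = d + 1) with hB
  have hAB : A.card + B.card = V.card := card_filter_add_card_filter_not _
  have hA1 : (d + 1) * A.card ≤ K.card := by
    have h1 : ∑ x ∈ A, (starOf K x).card = A.card * (d + 1) := by
      rw [Finset.sum_const_nat]
      intro x hx
      exact (mem_filter.mp hx).2
    have h2 : ∑ f ∈ K, (A.filter (fun x => x ∈ f)).card ≤ ∑ f ∈ K, 1 := by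
      apply Finset.sum_le_sum
      intro f hf
      rw [card_le_one]
      intro x hx u hu
      rw [mem_filter] at hx hu
      exact small_unique hd hK hns hf hx.2 hu.2 (mem_filter.mp hx.1).2 (mem_filter.mp hu.1).2
    rw [← double_count, h1] at h2
    simp at h2
    linarith
  have htot : ∑ x ∈ V, (starOf K x).card ≤ (d + 1) * K.card := by
    rw [double_count, mul_comm]
    have : ∑ f ∈ K, (V.filter (fun x => x ∈ f)).card ≤ ∑ f ∈ K, (d + 1) := by
      apply Finset.sum_le_sum
      intro f hf
      rw [← mem_allFaces.mp (hK.1.1 hf)]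
      apply card_le_card
      intro x hx
      exact (mem_filter.mp hx).2
    simpa using this
  have hsplit : ∑ x ∈ A, (starOf K x).card + ∑ x ∈ B, (starOf K x).card
      = ∑ x ∈ V, (starOf K x).card := sum_filter_add_sum_filter_not _ _ _
  have hA2 : A.card * (d + 1) ≤ ∑ x ∈ A, (starOf K x).card := by
    rw [← smul_eq_mul]
    apply card_nsmul_le_sum
    intro x hx
    exact (mem_filter.mp hx).2.ge
  have hB2 : B.card * (d + 2) ≤ ∑ x ∈ B, (starOf K x).card := by
    rw [← smul_eq_mul]
    apply card_nsmul_le_sum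
    intro x hx
    rw [mem_filter, hV, mem_biUnion] at hx
    obtain ⟨⟨f, hf, hxf⟩, h⟩ := hx
    have := deg_ge hK.1 hf hxf
    omega
  rw [← hAB]
  have h5 : A.card * (d + 1) + B.card * (d + 2) ≤ (d + 1) * K.card := by omega
  nlinarith

lemma bd_erase {n : ℕ} {σ : Finset (Fin n)} {a : Fin n} (ha : a ∈ σ) :
    bdCoeff (σ.erase a) σ = (-1 : ℝ) ^ (σ.filter (fun w => w < a)).card := by
  have hpos : 0 < σ.card := card_pos.mpr ⟨a, ha⟩
  have h1 : σ \ σ.erase a = {a} := by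
    ext y
    simp only [Finset.mem_sdiff, mem_erase, mem_singleton]
    constructor
    · rintro ⟨h1, h2⟩
      by_contra h
      exact h2 ⟨h, h1⟩
    · rintro rfl
      exact ⟨ha, fun h => h.1 rfl⟩
  rw [bdCoeff, if_pos ⟨erase_subset _ _, by rw [card_erase_of_mem ha]; omega⟩, h1, sum_singleton]

lemma bd_pair {n : ℕ} {W : Finset (Fin n)} {a b : Fin n} (ha : a ∈ W) (hb : b ∈ W) (hab : a < b) :
    bdCoeff (W.erase a) W * bdCoeff ((W.erase a).erase b) (W.erase a) +
    bdCoeff (W.erase b) W * bdCoeff ((W.erase a).erase b) (W.erase b) = 0 := by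
  have h1 : (W.erase a).erase b = (W.erase b).erase a := erase_right_comm
  rw [bd_erase ha, bd_erase hb, bd_erase (mem_erase.mpr ⟨hab.ne', hb⟩), h1,
    bd_erase (mem_erase.mpr ⟨hab.ne, ha⟩)]
  have e1 : (W.erase b).filter (fun w => w < a) = W.filter (fun w => w < a) := by
    rw [filter_erase, erase_eq_of_notMem]
    simp [hab.le]
  have e2 : (W.filter (fun w => w < b)).card = ((W.erase a).filter (fun w => w < b)).card + 1 := by
    have hm : a ∈ W.filter (fun w => w < b) := mem_filter.mpr ⟨ha, hab⟩
    rw [filter_erase, card_erase_of_mem hm]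
    have : 0 < (W.filter (fun w => w < b)).card := card_pos.mpr ⟨a, hm⟩
    omega
  rw [e1, e2, pow_succ]
  ring

lemma bd_supp {n : ℕ} {τ σ : Finset (Fin n)} (h : bdCoeff τ σ ≠ 0) :
    τ ⊆ σ ∧ τ.card + 1 = σ.card := by
  by_contra hc
  exact h (by rw [bdCoeff, if_neg hc])

lemma simplexCycle_ker {n d : ℕ} {F : Finset (Finset (Fin n))} {W : Finset (Fin n)}
    (hW : W.card = d + 2) (hF : W.powersetCard (d + 1) ⊆ F) :
    simplexCycle n F W ∈ LinearMap.ker (boundaryMap n F) := by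
  rw [LinearMap.mem_ker]
  funext τ
  show ∑ σ ∈ F.attach, bdCoeff σ.1 W * bdCoeff τ σ.1 = 0
  rw [Finset.sum_attach F (fun σ => bdCoeff σ W * bdCoeff τ σ)]
  by_cases hτ : τ ⊆ W ∧ τ.card = d
  · obtain ⟨hτW, hτc⟩ := hτ
    have hc : (W \ τ).card = 2 := by rw [card_sdiff_of_subset hτW]; omega
    obtain ⟨a, b, hab, hWt⟩ : ∃ a b, a < b ∧ W \ τ = {a, b} := by
      obtain ⟨a, b, hne, h⟩ := card_eq_two.mp hc
      rcases lt_or_gt_of_ne hne with h' | h'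
      · exact ⟨a, b, h', h⟩
      · exact ⟨b, a, h', by rw [h, pair_comm]⟩
    have ham : a ∈ W \ τ := by rw [hWt]; simp
    have hbm : b ∈ W \ τ := by rw [hWt]; simp
    rw [Finset.mem_sdiff] at ham hbm
    have hτe : τ = (W.erase a).erase b := by
      ext y
      simp only [mem_erase]
      constructor
      · intro hy
        exact ⟨fun h => hbm.2 (h ▸ hy), fun h => ham.2 (h ▸ hy), hτW hy⟩
      · rintro ⟨h1, h2, h3⟩
        by_contra hy
        have : y ∈ W \ τ := Finset.mem_sdiff.mpr ⟨h3, hy⟩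
        rw [hWt] at this
        simp [h1, h2] at this
    have hne : W.erase a ≠ W.erase b := by
      intro h
      have : b ∈ W.erase a := mem_erase.mpr ⟨hab.ne', hbm.1⟩
      rw [h] at this
      simp at this
    have hmemF : ∀ y ∈ W, W.erase y ∈ F := by
      intro y hy
      apply hF
      rw [mem_powersetCard, card_erase_of_mem hy]
      exact ⟨erase_subset _ _, by omega⟩
    have hsub : ({W.erase a, W.erase b} : Finset (Finset (Fin n))) ⊆ F := by
      intro y hy
      rw [mem_insert, mem_singleton] at hy
      rcases hy with rfl | rfl
      · exact hmemF a ham.1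
      · exact hmemF b hbm.1
    rw [← Finset.sum_subset hsub, sum_pair hne]
    · rw [hτe]; exact bd_pair ham.1 hbm.1 hab
    · intro σ _ hσ
      by_contra hcon
      obtain ⟨h1, h2⟩ := bd_supp (left_ne_zero_of_mul hcon)
      obtain ⟨h3, h4⟩ := bd_supp (right_ne_zero_of_mul hcon)
      apply hσ
      have hc1 : (W \ σ).card = 1 := by rw [card_sdiff_of_subset h1]; omega
      obtain ⟨y, hy⟩ := card_eq_one.mp hc1
      have hσe : σ = W.erase y := by
        rw [erase_eq, ← hy, Finset.sdiff_sdiff_eq_self h1]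
      have hym : y ∈ W \ σ := by rw [hy]; simp
      rw [Finset.mem_sdiff] at hym
      have : y ∈ W \ τ := Finset.mem_sdiff.mpr ⟨hym.1, fun h => hym.2 (h3 h)⟩
      rw [hWt, mem_insert, mem_singleton] at this
      rw [hσe]
      rcases this with rfl | rfl <;> simp
  · apply Finset.sum_eq_zero
    intro σ _
    by_contra hcon
    obtain ⟨h1, h2⟩ := bd_supp (left_ne_zero_of_mul hcon)
    obtain ⟨h3, h4⟩ := bd_supp (right_ne_zero_of_mul hcon)
    exact hτ ⟨h3.trans h1, by omega⟩

lemma mem_suppOf {n : ℕ} {F : Finset (Finset (Fin n))} {z : ↥F → ℝ} {σ : Finset (Fin n)} :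
    σ ∈ suppOf z ↔ ∃ h : σ ∈ F, z ⟨σ, h⟩ ≠ 0 := by
  simp [suppOf]

lemma simplexCycle_supp {n d : ℕ} {F : Finset (Finset (Fin n))} {W : Finset (Fin n)}
    (hW : W.card = d + 2) (hF : W.powersetCard (d + 1) ⊆ F) :
    suppOf (simplexCycle n F W) = W.powersetCard (d + 1) := by
  ext σ
  rw [mem_suppOf]
  constructor
  · rintro ⟨_, h⟩
    obtain ⟨h1, h2⟩ := bd_supp (show bdCoeff σ W ≠ 0 from h)
    exact mem_powersetCard.mpr ⟨h1, by omega⟩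
  · intro h
    refine ⟨hF h, ?_⟩
    rw [mem_powersetCard] at h
    show bdCoeff σ W ≠ 0
    have hc1 : (W \ σ).card = 1 := by rw [card_sdiff_of_subset h.1]; omega
    obtain ⟨y, hy⟩ := card_eq_one.mp hc1
    have hσe : σ = W.erase y := by
      rw [erase_eq, ← hy, Finset.sdiff_sdiff_eq_self h.1]
    have hym : y ∈ W \ σ := by rw [hy]; simp
    rw [hσe, bd_erase (Finset.mem_sdiff.mp hym).1]
    exact pow_ne_zero _ (by norm_num)

lemma supp_core {n d : ℕ} {F : Finset (Finset (Fin n))} (hF : F ⊆ allFaces n d)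
    {z : ↥F → ℝ} (hz : z ∈ LinearMap.ker (boundaryMap n F)) (hz0 : z ≠ 0) :
    IsCore n d (suppOf z) := by
  refine ⟨?_, ?_, ?_⟩
  · intro σ hσ
    obtain ⟨h, _⟩ := mem_suppOf.mp hσ
    exact hF h
  · obtain ⟨σ, hσ⟩ := Function.ne_iff.mp hz0
    exact ⟨σ.1, mem_suppOf.mpr ⟨σ.2, hσ⟩⟩
  · intro f hf a ha
    obtain ⟨hfF, hzf⟩ := mem_suppOf.mp hf
    have h0 : ∑ σ ∈ F.attach, z σ * bdCoeff (f.erase a) σ.1 = 0 :=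
      congrFun (LinearMap.mem_ker.mp hz) (f.erase a)
    have hterm : z ⟨f, hfF⟩ * bdCoeff (f.erase a) f ≠ 0 := by
      rw [bd_erase ha]
      exact mul_ne_zero hzf (pow_ne_zero _ (by norm_num))
    by_contra hcon
    push Not at hcon
    apply hterm
    rw [Finset.sum_eq_single (⟨f, hfF⟩ : ↥F)] at h0
    · exact h0
    · intro σ _ hσ
      by_contra hne
      have h1 : σ.1 ∈ suppOf z := mem_suppOf.mpr ⟨σ.2, left_ne_zero_of_mul hne⟩
      exact hcon σ.1 h1 (fun h => hσ (Subtype.ext h)) (bd_supp (right_ne_zero_of_mul hne)).1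
    · intro h; exact absurd (mem_attach _ _) h

lemma exists_minCore {n d : ℕ} {K : Finset (Finset (Fin n))} (hK : IsCore n d K) :
    ∃ K' ⊆ K, MinCore n d K' := by
  have hne : (K.powerset.filter (fun K' => IsCore n d K')).Nonempty :=
    ⟨K, mem_filter.mpr ⟨mem_powerset.mpr (Subset.refl _), hK⟩⟩
  obtain ⟨K', hK', hmin⟩ := exists_min_image _ (fun K' => K'.card) hne
  simp only [mem_filter, mem_powerset] at hK' hmin
  refine ⟨K', hK'.1, hK'.2, ?_⟩
  intro K2 h2 hc
  exact eq_of_subset_of_card_le h2 (hmin K2 ⟨h2.trans hK'.1, hc⟩)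

lemma reduction {n d : ℕ} {F : Finset (Finset (Fin n))} (hF : F ⊆ allFaces n d)
    {z : ↥F → ℝ} (hz : z ∈ LinearMap.ker (boundaryMap n F)) (hz0 : z ≠ 0)
    (hmin : ∀ w : ↥F → ℝ, w ∈ LinearMap.ker (boundaryMap n F) → w ≠ 0 →
              suppOf w ⊆ suppOf z → suppOf w = suppOf z) :
    (∃ τ : Finset (Fin n), τ.card = d + 2 ∧
                suppOf z = τ.powerset.filter (fun s => s.card = d + 1)) ∨
    ∃ K ⊆ F, K ⊆ suppOf z ∧ MinCore n d K ∧
      ¬ ∃ W : Finset (Fin n), W.card = d + 2 ∧ K = W.powersetCard (d + 1) := by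
  obtain ⟨K, hKz, hK⟩ := exists_minCore (supp_core hF hz hz0)
  have hKF : K ⊆ F := fun σ hσ => (mem_suppOf.mp (hKz hσ)).1
  by_cases h : ∃ W : Finset (Fin n), W.card = d + 2 ∧ K = W.powersetCard (d + 1)
  · left
    obtain ⟨W, hW, rfl⟩ := h
    refine ⟨W, hW, ?_⟩
    have hs := simplexCycle_supp hW hKF
    rw [← hmin (simplexCycle n F W) (simplexCycle_ker hW hKF) ?_ (by rw [hs]; exact hKz), hs,
      powersetCard_eq_filter]
    intro h0
    obtain ⟨σ, hσ⟩ := (simplex_core hW).2.1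
    rw [← hs, h0, mem_suppOf] at hσ
    obtain ⟨_, h⟩ := hσ
    exact h rfl
  · exact Or.inr ⟨K, hKF, hKz, hK, h⟩

lemma face_deg {n d : ℕ} (A : Finset (Finset (Fin n))) (hA : A ⊆ allFaces n d) :
    ((allFaces n d \ A).filter (fun y => ∃ b ∈ A, faceAdj n d b y)).card
      ≤ ((d + 1) * n) * A.card := by
  have hsub : (allFaces n d \ A).filter (fun y => ∃ b ∈ A, faceAdj n d b y) ⊆
      A.biUnion (fun f => (f ×ˢ (univ : Finset (Fin n))).image
        (fun ab => insert ab.2 (f.erase ab.1))) := by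
    intro g hg
    rw [mem_filter, Finset.mem_sdiff] at hg
    obtain ⟨⟨hg, hgA⟩, f, hf, hfg⟩ := hg
    have hfc := mem_allFaces.mp (hA hf)
    have hgc := mem_allFaces.mp hg
    unfold faceAdj at hfg
    have h1 : (f \ g).card = 1 := by
      have := card_sdiff_add_card_inter f g
      omega
    have h2 : (g \ f).card = 1 := by
      have := card_sdiff_add_card_inter g f
      rw [inter_comm] at this
      omega
    obtain ⟨a, ha⟩ := card_eq_one.mp h1
    obtain ⟨b, hb⟩ := card_eq_one.mp h2
    rw [mem_biUnion]
    refine ⟨f, hf, mem_image.mpr ⟨(a, b), ?_, ?_⟩⟩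
    · rw [mem_product]
      refine ⟨?_, mem_univ _⟩
      have : a ∈ f \ g := by rw [ha]; simp
      exact (Finset.mem_sdiff.mp this).1
    · ext x
      have hx1 : x ∈ f \ g ↔ x = a := by rw [ha]; simp
      have hx2 : x ∈ g \ f ↔ x = b := by rw [hb]; simp
      rw [Finset.mem_sdiff] at hx1 hx2
      simp only [mem_insert, mem_erase]
      tauto
  refine (card_le_card hsub).trans ?_
  rw [mul_comm]
  refine card_biUnion_le_card_mul _ _ _ (fun f hf => ?_)
  refine card_image_le.trans ?_
  rw [card_product, mem_allFaces.mp (hA hf)]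
  simp

lemma allFaces_card (n d : ℕ) : (allFaces n d).card ≤ n ^ (d + 1) := by
  have : allFaces n d = (univ : Finset (Fin n)).powersetCard (d + 1) := by
    ext f; simp [mem_allFaces, mem_powersetCard]
  rw [this, card_powersetCard]
  simpa using Nat.choose_le_pow n (d + 1)

lemma face_animals {n d : ℕ} (hn : 2 ≤ n) (r : Finset (Fin n)) (k : ℕ) :
    (((allFaces n d).powerset.filter
      (fun A => ConnF (faceAdj n d) r A ∧ A.card = k)).card : ℝ) ≤ (4 * ((d : ℝ) + 1) * n) ^ k := by
  have := animals (allFaces n d) (faceAdj n d) r ((d + 1) * n) (by nlinarith) (fun A hA => face_deg A hA) k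
  push_cast at this
  rwa [← mul_assoc] at this

/-- minimal cores of size `m` -/
def cores (n d m : ℕ) : Finset (Finset (Finset (Fin n))) :=
  (allFaces n d).powerset.filter (fun K => MinCore n d K ∧ K.card = m)

lemma cores_large_sub {n d : ℕ} (hd : 2 ≤ d) (m : ℕ) :
    cores n d m ⊆ (allFaces n d).biUnion fun r =>
      ((range (m + 1)).filter (fun k => m ≤ 5 * (d + 2) * (m - k))).biUnion fun k =>
        ((allFaces n d).powerset.filter
          (fun A => ConnF (faceAdj n d) r A ∧ A.card = k ∧ k ≤ m)).biUnion fun K1 =>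
            ((cand n d K1).powersetCard (m - k)).image (fun K2 => K1 ∪ K2) := by
  intro K hK
  rw [cores, mem_filter, mem_powerset] at hK
  obtain ⟨hKa, hK, hm⟩ := hK
  obtain ⟨r, hr⟩ := hK.1.2.1
  obtain ⟨K1, hK1, hconn, hc, hcand⟩ := core_decomp hd hK hr
  have hle := card_le_card hK1
  have hsd : (K \ K1).card = m - K1.card := by rw [card_sdiff_of_subset hK1, hm]
  rw [mem_biUnion]
  refine ⟨r, hKa hr, ?_⟩
  rw [mem_biUnion]
  refine ⟨K1.card, ?_, ?_⟩
  · rw [mem_filter, mem_range, ← hsd, ← hm]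
    exact ⟨by omega, hc⟩
  rw [mem_biUnion]
  refine ⟨K1, ?_, ?_⟩
  · rw [mem_filter, mem_powerset]
    exact ⟨hK1.trans hKa, hconn, rfl, by omega⟩
  rw [mem_image]
  refine ⟨K \ K1, ?_, union_sdiff_of_subset hK1⟩
  rw [mem_powersetCard]
  refine ⟨?_, hsd⟩
  intro f hf
  rw [cand, mem_filter]
  exact ⟨hKa (Finset.mem_sdiff.mp hf).1, hcand f hf⟩

lemma choose_bound (m j k0 n : ℕ) (ρ : ℝ) (Q : ℕ) (hρ0 : 0 < ρ) (hρ1 : ρ ≤ 1)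
    (hk0 : (k0 : ℝ) ≤ ρ ^ Q * n) (hj : m ≤ Q * j) :
    (((m * k0).choose j : ℕ) : ℝ) ≤ (n : ℝ) ^ j * ρ ^ m * (Real.exp 1) ^ m := by
  have h1 : (((m * k0).choose j : ℕ) : ℝ) ≤ ((m * k0 : ℕ) : ℝ) ^ j / (j.factorial : ℝ) :=
    Nat.choose_le_pow_div j (m * k0)
  have h2 : (m : ℝ) ^ j / (j.factorial : ℝ) ≤ Real.exp 1 ^ m := by
    have := Real.pow_div_factorial_le_exp (x := (m : ℝ)) (by positivity) j
    refine this.trans (le_of_eq ?_)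
    rw [← Real.exp_nat_mul]; simp
  have h3 : (k0 : ℝ) ^ j ≤ (n : ℝ) ^ j * ρ ^ m := by
    calc (k0 : ℝ) ^ j ≤ (ρ ^ Q * n) ^ j := by gcongr
      _ = (n : ℝ) ^ j * ρ ^ (Q * j) := by rw [mul_pow, ← pow_mul]; ring
      _ ≤ _ := by
        gcongr ?_ * ?_
        exact pow_le_pow_of_le_one hρ0.le hρ1 hj
  refine h1.trans ?_
  push_cast
  rw [mul_pow, mul_div_right_comm, mul_comm]
  exact mul_le_mul h3 h2 (by positivity) (by positivity)

lemma cores_large {n d : ℕ} (hd : 2 ≤ d) (hn : 2 ≤ n) (m k0 : ℕ) (ρ : ℝ) (hρ0 : 0 < ρ) (hρ1 : ρ ≤ 1)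
    (hk0 : (k0 : ℝ) ≤ ρ ^ (5 * (d + 2)) * n) (hk : (d + 1) * m < k0.choose d) :
    ((cores n d m).card : ℝ) ≤ (n : ℝ) ^ (d + 1) * ((m + 1 : ℝ) *
      (4 * ((d : ℝ) + 1) * n * ρ * Real.exp 1) ^ m) := by
  have hk0n : k0 ≤ n := by
    have : (k0 : ℝ) ≤ n := hk0.trans (by
      have : ρ ^ (5 * (d + 2)) ≤ 1 := pow_le_one₀ hρ0.le hρ1
      nlinarith [Nat.cast_nonneg (α := ℝ) n])
    exact_mod_cast this
  set X : ℝ := (4 * ((d : ℝ) + 1) * n * ρ * Real.exp 1) ^ m with hX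
  have hX0 : 0 ≤ X := by positivity
  have hkey : ∀ r k, k ∈ ((range (m + 1)).filter (fun k => m ≤ 5 * (d + 2) * (m - k))) →
      (((((allFaces n d).powerset.filter
          (fun A => ConnF (faceAdj n d) r A ∧ A.card = k ∧ k ≤ m)).biUnion fun K1 =>
            ((cand n d K1).powersetCard (m - k)).image (fun K2 => K1 ∪ K2)).card : ℕ) : ℝ) ≤ X := by
    intro r k hkk
    rw [mem_filter, mem_range] at hkk
    have hkm : k ≤ m := by omega
    have hb := choose_bound m (m - k) k0 n ρ (5 * (d + 2)) hρ0 hρ1 hk0 hkk.2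
    have h1 : (((allFaces n d).powerset.filter
          (fun A => ConnF (faceAdj n d) r A ∧ A.card = k ∧ k ≤ m)).biUnion fun K1 =>
            ((cand n d K1).powersetCard (m - k)).image (fun K2 => K1 ∪ K2)).card ≤
        ((allFaces n d).powerset.filter
          (fun A => ConnF (faceAdj n d) r A ∧ A.card = k ∧ k ≤ m)).card * (m * k0).choose (m - k) := by
      refine card_biUnion_le_card_mul _ _ _ (fun K1 hK1 => ?_)
      rw [mem_filter, mem_powerset] at hK1
      refine card_image_le.trans ?_
      rw [card_powersetCard]
      refine Nat.choose_le_choose _ ?_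
      refine (cand_card (fun f hf => mem_allFaces.mp (hK1.1 hf)) k0 (by omega) hk0n ?_).trans ?_
      · refine lt_of_le_of_lt ?_ hk
        gcongr
        omega
      · gcongr
        omega
    have h2 : (((allFaces n d).powerset.filter
          (fun A => ConnF (faceAdj n d) r A ∧ A.card = k ∧ k ≤ m)).card : ℝ) ≤
          (4 * ((d : ℝ) + 1) * n) ^ k := by
      refine le_trans ?_ (face_animals hn r k)
      norm_cast
      refine card_le_card ?_
      intro A hA
      rw [mem_filter] at hA ⊢
      exact ⟨hA.1, hA.2.1, hA.2.2.1⟩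
    calc _ ≤ (((allFaces n d).powerset.filter
          (fun A => ConnF (faceAdj n d) r A ∧ A.card = k ∧ k ≤ m)).card : ℝ)
            * ((m * k0).choose (m - k) : ℕ) := by exact_mod_cast h1
      _ ≤ (4 * ((d : ℝ) + 1) * n) ^ k * ((n : ℝ) ^ (m - k) * ρ ^ m * (Real.exp 1) ^ m) := by
        gcongr
      _ = (4 * ((d : ℝ) + 1)) ^ k * ((n : ℝ) ^ (k + (m - k))) * ρ ^ m * (Real.exp 1) ^ m := by
        rw [pow_add, mul_pow]; ring
      _ ≤ (4 * ((d : ℝ) + 1)) ^ m * ((n : ℝ) ^ (k + (m - k))) * ρ ^ m * (Real.exp 1) ^ m := by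
        gcongr
        have : (0 : ℝ) ≤ d := by positivity
        linarith
      _ = X := by rw [hX, Nat.add_sub_cancel' hkm]; simp only [mul_pow]
  have hfin : ((cores n d m).card : ℝ) ≤ ∑ r ∈ allFaces n d, ∑ k ∈ (range (m + 1)).filter (fun k => m ≤ 5 * (d + 2) * (m - k)), X := by
    refine le_trans (Nat.cast_le.mpr (card_le_card (cores_large_sub hd m))) ?_
    refine le_trans (Nat.cast_le.mpr card_biUnion_le) ?_
    push_cast
    refine sum_le_sum fun r _ => ?_
    refine le_trans (Nat.cast_le.mpr card_biUnion_le) ?_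
    push_cast
    exact sum_le_sum fun k hk => hkey r k hk
  refine hfin.trans ?_
  simp only [sum_const, nsmul_eq_mul]
  have ha : ((allFaces n d).card : ℝ) ≤ (n : ℝ) ^ (d + 1) := by exact_mod_cast allFaces_card n d
  have hb : (((range (m + 1)).filter (fun k => m ≤ 5 * (d + 2) * (m - k))).card : ℝ) ≤ (m : ℝ) + 1 := by
    have := card_filter_le (range (m + 1)) (fun k => m ≤ 5 * (d + 2) * (m - k))
    rw [card_range] at this
    exact_mod_cast this
  gcongr

/-- non-simplicial minimal cores of size `m` -/
def ncores (n d m : ℕ) : Finset (Finset (Finset (Fin n))) :=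
  (cores n d m).filter (fun K => ¬∃ W : Finset (Fin n), W.card = d + 2 ∧ K = W.powersetCard (d + 1))


lemma exists_enum {α : Type*} [DecidableEq α] (V : Finset α) (s : ℕ) (hV : V.Nonempty) (hs : V.card ≤ s) :
    ∃ g : Fin s → α, univ.image g = V := by
  obtain ⟨v0, hv0⟩ := hV
  refine ⟨fun i => if h : i.1 < V.card then (V.equivFin.symm ⟨i.1, h⟩).1 else v0, ?_⟩
  ext x
  simp only [mem_image, mem_univ, true_and]
  constructor
  · rintro ⟨i, rfl⟩
    split_ifs with h
    · exact (V.equivFin.symm ⟨i.1, h⟩).2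
    · exact hv0
  · intro hx
    refine ⟨⟨(V.equivFin ⟨x, hx⟩).1, lt_of_lt_of_le (V.equivFin ⟨x, hx⟩).2 hs⟩, ?_⟩
    simp

lemma ncores_small {n d : ℕ} (hd : 2 ≤ d) (m : ℕ) :
    ∃ s : ℕ, s ≤ m ∧ (d + 1) * (d + 2) * s + d * m ≤ (d + 1) * (d + 2) * m ∧
      (ncores n d m).card ≤ n ^ s * s ^ ((d + 1) * m) := by
  set q := (d + 1) * (d + 2) with hq
  have hq0 : 0 < q := by positivity
  have hdq : d ≤ q := by nlinarith
  set s := (q * m - d * m) / q with hs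
  have hs1 : q * s ≤ q * m - d * m := Nat.mul_div_le _ _
  have hdm : d * m ≤ q * m := Nat.mul_le_mul_right _ hdq
  have hsm : s ≤ m := by
    refine Nat.le_of_mul_le_mul_left (c := q) ?_ hq0
    omega
  refine ⟨s, hsm, by omega, ?_⟩
  have hsub : ncores n d m ⊆ (univ : Finset ((Fin s → Fin n) × (Fin m → Fin (d + 1) → Fin s))).image
      (fun gh => univ.image (fun i => univ.image (fun j => gh.1 (gh.2 i j)))) := by
    intro K hK
    rw [ncores, mem_filter, cores, mem_filter, mem_powerset] at hK
    obtain ⟨⟨hKa, hK, hm⟩, hns⟩ := hK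
    have hvc := vertex_count hd hK hns
    have hKc : ∀ f ∈ K, f.card = d + 1 := fun f hf => mem_allFaces.mp (hKa hf)
    have hVs : (K.biUnion id).card ≤ s := by
      rw [hs, Nat.le_div_iff_mul_le hq0]
      rw [hm, ← hq] at hvc
      rw [mul_comm]
      omega
    have hne := hK.1.2.1
    have hVne : (K.biUnion id).Nonempty := by
      obtain ⟨f, hf⟩ := hne
      have : 0 < f.card := by rw [hKc f hf]; omega
      obtain ⟨x, hx⟩ := card_pos.mp this
      exact ⟨x, mem_biUnion.mpr ⟨f, hf, hx⟩⟩
    obtain ⟨g, hg⟩ := exists_enum _ s hVne hVs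
    obtain ⟨e, he⟩ := exists_enum K m hne hm.le
    have heK : ∀ i, e i ∈ K := fun i => by rw [← he]; exact mem_image_of_mem _ (mem_univ _)
    have hen : ∀ i, ∃ t : Fin (d + 1) → Fin n, univ.image t = e i := fun i =>
      exists_enum (e i) (d + 1) (card_pos.mp (by rw [hKc _ (heK i)]; omega)) (hKc _ (heK i)).le
    choose t ht using hen
    have hpre : ∀ i j, ∃ x, g x = t i j := by
      intro i j
      have : t i j ∈ K.biUnion id := mem_biUnion.mpr ⟨e i, heK i, by
        rw [id, ← ht]; exact mem_image_of_mem _ (mem_univ _)⟩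
      rw [← hg, mem_image] at this
      obtain ⟨x, -, hx⟩ := this
      exact ⟨x, hx⟩
    choose h hh using hpre
    rw [mem_image]
    refine ⟨(g, h), mem_univ _, ?_⟩
    simp only [hh]
    rw [← he]
    congr 1
    funext i
    exact ht i
  refine (card_le_card hsub).trans (card_image_le.trans ?_)
  simp [← pow_mul]

lemma small_term {n d : ℕ} (hd : 2 ≤ d) (hn : 1 ≤ n) (m : ℕ)
    (hmn : m ^ ((d + 1) * (d + 2) * (d + 1)) ≤ n) (c : ℝ) (hc : 0 < c) :
    ((ncores n d m).card : ℝ) * (c / n) ^ m ≤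
      (c * (n : ℝ) ^ (-(1 / (((d + 1) * (d + 2) : ℕ) : ℝ)))) ^ m := by
  obtain ⟨s, hsm, hs, hcard⟩ := ncores_small (n := n) hd m
  set q := (d + 1) * (d + 2) with hq
  have hq0 : q ≠ 0 := by positivity
  have hn0 : (0 : ℝ) < n := by exact_mod_cast hn
  have hn1 : (1 : ℝ) ≤ n := by exact_mod_cast hn
  refine le_of_pow_le_pow_left₀ hq0 (by positivity) ?_
  have hr : ((n : ℝ) ^ (-(1 / (q : ℝ)))) ^ q = (n : ℝ)⁻¹ := by
    rw [← Real.rpow_natCast, ← Real.rpow_mul hn0.le]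
    have : -(1 / (q : ℝ)) * q = -1 := by
      have : (q : ℝ) ≠ 0 := by exact_mod_cast hq0
      field_simp
    rw [this, Real.rpow_neg_one]
  have hR : ((c * (n : ℝ) ^ (-(1 / (q : ℝ)))) ^ m) ^ q = (c ^ q) ^ m * ((n : ℝ)⁻¹) ^ m := by
    rw [← pow_mul, mul_comm m q, pow_mul, mul_pow, hr, mul_pow]
  rw [hR]
  have hcard' : ((ncores n d m).card : ℝ) ≤ (n : ℝ) ^ s * (m : ℝ) ^ ((d + 1) * m) := by
    have : (ncores n d m).card ≤ n ^ s * m ^ ((d + 1) * m) := hcard.trans (by gcongr)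
    exact_mod_cast this
  have hmn' : (m : ℝ) ^ (q * (d + 1)) ≤ n := by exact_mod_cast hmn
  have h1 : ((m : ℝ) ^ ((d + 1) * m)) ^ q ≤ (n : ℝ) ^ m := by
    calc ((m : ℝ) ^ ((d + 1) * m)) ^ q = ((m : ℝ) ^ (q * (d + 1))) ^ m := by
          rw [← pow_mul, ← pow_mul]; congr 1; ring
      _ ≤ _ := by gcongr
  have h2 : ((n : ℝ) ^ s) ^ q * (n : ℝ) ^ m * (n : ℝ) ^ m ≤ (n : ℝ) ^ (q * m) := by
    rw [← pow_mul, ← pow_add, ← pow_add]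
    refine pow_le_pow_right₀ hn1 ?_
    nlinarith [Nat.mul_le_mul_right m hd]
  calc (((ncores n d m).card : ℝ) * (c / n) ^ m) ^ q
      ≤ ((n : ℝ) ^ s * (m : ℝ) ^ ((d + 1) * m) * (c / n) ^ m) ^ q := by gcongr
    _ = ((n : ℝ) ^ s) ^ q * ((m : ℝ) ^ ((d + 1) * m)) ^ q * ((c ^ q) ^ m / (n : ℝ) ^ (q * m)) := by
        rw [mul_pow, mul_pow, div_pow, div_pow, ← pow_mul c, ← pow_mul c, ← pow_mul (n : ℝ) m q,
          mul_comm m q]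
    _ ≤ ((n : ℝ) ^ s) ^ q * (n : ℝ) ^ m * ((c ^ q) ^ m / (n : ℝ) ^ (q * m)) := by gcongr
    _ ≤ (c ^ q) ^ m * ((n : ℝ)⁻¹) ^ m := by
        rw [inv_pow, ← div_eq_mul_inv, ← mul_div_assoc, div_le_div_iff₀ (by positivity) (by positivity)]
        have : 0 ≤ (c ^ q) ^ m := by positivity
        nlinarith

lemma large_term {n d : ℕ} (hd : 2 ≤ d) (hn : 2 ≤ n) (m k0 : ℕ) (ρ c : ℝ) (hc : 0 < c)
    (hρ0 : 0 < ρ) (hρ1 : ρ ≤ 1)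
    (hρc : 4 * ((d : ℝ) + 1) * ρ * Real.exp 1 * c ≤ 1 / 2)
    (hk0 : (k0 : ℝ) ≤ ρ ^ (5 * (d + 2)) * n) (hk : (d + 1) * m < k0.choose d)
    (B : ℕ) (hm : n < m ^ B) :
    ((ncores n d m).card : ℝ) * (c / n) ^ m ≤
      (n : ℝ)⁻¹ * ((m + 1 : ℝ) * (m : ℝ) ^ (B * (d + 2)) * (1 / 2) ^ m) := by
  have hn0 : (0 : ℝ) < n := by positivity
  have h1 : ((ncores n d m).card : ℝ) ≤ (cores n d m).card := by
    exact_mod_cast card_le_card (filter_subset _ _)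
  have h2 := cores_large hd hn m k0 ρ hρ0 hρ1 hk0 hk
  have hm' : (n : ℝ) ≤ (m : ℝ) ^ B := by exact_mod_cast hm.le
  calc ((ncores n d m).card : ℝ) * (c / n) ^ m
      ≤ (n : ℝ) ^ (d + 1) * ((m + 1 : ℝ) *
      (4 * ((d : ℝ) + 1) * n * ρ * Real.exp 1) ^ m) * (c / n) ^ m := by
        gcongr; exact h1.trans h2
    _ = (n : ℝ) ^ (d + 1) * ((m + 1 : ℝ) * (4 * ((d : ℝ) + 1) * ρ * Real.exp 1 * c) ^ m) := by
        rw [mul_assoc, mul_assoc, ← mul_pow]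
        have : 4 * ((d : ℝ) + 1) * n * ρ * Real.exp 1 * (c / n) = 4 * ((d : ℝ) + 1) * ρ * Real.exp 1 * c := by
          field_simp
        rw [this]
    _ ≤ (n : ℝ) ^ (d + 1) * ((m + 1 : ℝ) * (1 / 2) ^ m) := by gcongr
    _ = (n : ℝ)⁻¹ * ((m + 1 : ℝ) * (n : ℝ) ^ (d + 2) * (1 / 2) ^ m) := by
        field_simp
        ring
    _ ≤ _ := by
        gcongr
        rw [pow_mul]
        gcongr

lemma poly_summable (D : ℕ) :
    Summable (fun m : ℕ => (m + 1 : ℝ) * (m : ℝ) ^ D * (1 / 2) ^ m) := by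
  have h1 := summable_pow_mul_geometric_of_norm_lt_one (R := ℝ) (D + 1) (r := 1 / 2) (by norm_num)
  have h2 := summable_pow_mul_geometric_of_norm_lt_one (R := ℝ) D (r := 1 / 2) (by norm_num)
  refine (h1.add h2).congr (fun m => ?_)
  ring

/-- sum over all bad cores of size below `M` -/
lemma bad_sum {n d : ℕ} (hd : 2 ≤ d) (hn : 2 ≤ n) (M k0 : ℕ) (ρ c : ℝ) (hc : 0 < c)
    (hρ0 : 0 < ρ) (hρ1 : ρ ≤ 1)
    (hρc : 4 * ((d : ℝ) + 1) * ρ * Real.exp 1 * c ≤ 1 / 2)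
    (hk0 : (k0 : ℝ) ≤ ρ ^ (5 * (d + 2)) * n) (hk : ∀ m ∈ range M, (d + 1) * m < k0.choose d)
    (hr : c * (n : ℝ) ^ (-(1 / (((d + 1) * (d + 2) : ℕ) : ℝ))) ≤ 1 / 2) :
    ∑ m ∈ range M, ((ncores n d m).card : ℝ) * (c / n) ^ m ≤
      4 * (c * (n : ℝ) ^ (-(1 / (((d + 1) * (d + 2) : ℕ) : ℝ)))) +
      (n : ℝ)⁻¹ * ∑' m : ℕ, (m + 1 : ℝ) * (m : ℝ) ^ (((d + 1) * (d + 2) * (d + 1)) * (d + 2)) * (1 / 2) ^ m := by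
  set r := c * (n : ℝ) ^ (-(1 / (((d + 1) * (d + 2) : ℕ) : ℝ))) with hrdef
  set B := (d + 1) * (d + 2) * (d + 1) with hB
  have hr0 : 0 ≤ r := by positivity
  have hterm : ∀ m ∈ range M, ((ncores n d m).card : ℝ) * (c / n) ^ m ≤
      r * (r ^ (m - 1)) + (n : ℝ)⁻¹ * ((m + 1 : ℝ) * (m : ℝ) ^ (B * (d + 2)) * (1 / 2) ^ m) := by
    intro m hm
    have hn0 : (0 : ℝ) < n := by positivity
    rcases Nat.eq_zero_or_pos m with rfl | hm0
    · have : ncores n d 0 = ∅ := by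
        rw [eq_empty_iff_forall_notMem]
        intro K hK
        rw [ncores, mem_filter, cores, mem_filter] at hK
        have := hK.1.2.1.1.2.1
        have h0 := hK.1.2.2
        rw [card_eq_zero] at h0
        rw [h0] at this
        exact not_nonempty_empty this
      rw [this]
      simp only [card_empty, Nat.cast_zero, zero_mul]
      positivity
    by_cases h : m ^ B ≤ n
    · have := small_term hd (by omega) m h c hc
      have h3 : r * r ^ (m - 1) = r ^ m := by
        rw [← pow_succ', Nat.sub_add_cancel hm0]
      rw [h3]
      have : 0 ≤ (n : ℝ)⁻¹ * ((m + 1 : ℝ) * (m : ℝ) ^ (B * (d + 2)) * (1 / 2) ^ m) := by positivity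
      linarith
    · have := large_term hd hn m k0 ρ c hc hρ0 hρ1 hρc hk0 (hk m hm) B (by omega)
      have : 0 ≤ r * r ^ (m - 1) := by positivity
      linarith
  refine (sum_le_sum hterm).trans ?_
  rw [sum_add_distrib, ← mul_sum, ← mul_sum]
  have hA : ∑ m ∈ range M, r ^ (m - 1) ≤ 4 := by
    have : ∀ m ∈ range M, r ^ (m - 1) ≤ 2 * (1 / 2 : ℝ) ^ m := by
      intro m _
      rcases Nat.eq_zero_or_pos m with rfl | hm0
      · norm_num
      · calc r ^ (m - 1) ≤ (1 / 2 : ℝ) ^ (m - 1) := by gcongr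
          _ = 2 * ((1 / 2 : ℝ) ^ (m - 1 + 1)) := by rw [pow_succ]; ring
          _ = _ := by rw [Nat.sub_add_cancel hm0]
    refine (sum_le_sum this).trans ?_
    rw [← mul_sum]
    have := sum_geometric_two_le M
    linarith
  have hBs := (poly_summable (B * (d + 2))).sum_le_tsum (range M) (fun m _ => by positivity)
  have : 0 ≤ (n : ℝ)⁻¹ := by positivity
  nlinarith [mul_le_mul_of_nonneg_left hA hr0, mul_le_mul_of_nonneg_left hBs this]

lemma total_weight {α : Type*} [DecidableEq α] (V : Finset α) (p : ℝ) :
    ∑ F ∈ V.powerset, p ^ F.card * (1 - p) ^ (V.card - F.card) = 1 := by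
  rw [Finset.sum_pow_mul_eq_add_pow]; simp

lemma union_bound {n d : ℕ} (p : ℝ) (hp0 : 0 ≤ p) (hp1 : p ≤ 1) (E : Finset (Finset (Fin n)) → Prop)
    (M : ℕ) (h : ∀ F ⊆ allFaces n d, ¬ E F → ∃ m ∈ range M, ∃ K ∈ ncores n d m, K ⊆ F) :
    1 - ∑ m ∈ range M, ((ncores n d m).card : ℝ) * p ^ m ≤ probY n d p E ∧ probY n d p E ≤ 1 := by
  set V := allFaces n d with hV
  set w : Finset (Finset (Fin n)) → ℝ := fun F => p ^ F.card * (1 - p) ^ (V.card - F.card) with hw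
  have hw0 : ∀ F, 0 ≤ w F := fun F => mul_nonneg (pow_nonneg hp0 _) (pow_nonneg (by linarith) _)
  have htot : ∑ F ∈ V.powerset, w F = 1 := total_weight V p
  have hE : probY n d p E = ∑ F ∈ V.powerset, if E F then w F else 0 := rfl
  have hK : ∀ m, ∀ K ∈ ncores n d m, ∑ F ∈ V.powerset, (if K ⊆ F then w F else 0) = p ^ m := by
    intro m K hK
    rw [ncores, mem_filter, cores, mem_filter, mem_powerset] at hK
    have := wsum_aux V K ∅ hK.1.1 (by simp) (by simp) p
    rw [hK.1.2.2] at this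
    rw [← sum_filter]
    simpa using this
  constructor
  · rw [hE, sub_le_iff_le_add, ← htot]
    have h1 : ∑ m ∈ range M, ((ncores n d m).card : ℝ) * p ^ m =
        ∑ F ∈ V.powerset, ∑ m ∈ range M, ∑ K ∈ ncores n d m, (if K ⊆ F then w F else 0) := by
      rw [sum_comm]
      refine sum_congr rfl fun m _ => ?_
      rw [sum_comm, sum_congr rfl (hK m), sum_const, nsmul_eq_mul]
    rw [h1, ← sum_add_distrib]
    refine sum_le_sum fun F hF => ?_
    have hnn : ∀ (_ : ℕ) (K : Finset (Finset (Fin n))), 0 ≤ (if K ⊆ F then w F else 0) := by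
      intro m K; split_ifs
      · exact hw0 F
      · exact le_refl _
    by_cases hEF : E F
    · rw [if_pos hEF]
      have : 0 ≤ ∑ m ∈ range M, ∑ K ∈ ncores n d m, (if K ⊆ F then w F else 0) :=
        sum_nonneg fun m _ => sum_nonneg fun K _ => hnn m K
      linarith
    · rw [if_neg hEF, zero_add]
      obtain ⟨m, hm, K, hKm, hKF⟩ := h F (mem_powerset.mp hF) hEF
      calc w F = (if K ⊆ F then w F else 0) := by rw [if_pos hKF]
        _ ≤ ∑ K ∈ ncores n d m, (if K ⊆ F then w F else 0) :=
          single_le_sum (f := fun K => if K ⊆ F then w F else 0) (fun K _ => hnn m K) hKm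
        _ ≤ _ := single_le_sum (f := fun m => ∑ K ∈ ncores n d m, (if K ⊆ F then w F else 0))
          (fun m _ => sum_nonneg fun K _ => hnn m K) hm
  · rw [hE, ← htot]
    refine sum_le_sum fun F _ => ?_
    split_ifs
    · exact le_refl _
    · exact hw0 F

lemma choose_large (d n : ℕ) (η : ℝ) (hη : 0 < η) (hn : 2 * d ≤ η * n) (m : ℕ)
    (hm : (m : ℝ) < (η / 2) ^ d / (d.factorial * (d + 1)) * (n : ℝ) ^ d) :
    (d + 1) * m < (⌊η * n⌋₊).choose d := by
  set k0 := ⌊η * n⌋₊ with hk0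
  have h1 : (((k0 + 1 - d : ℕ) : ℝ) ^ d) / d.factorial ≤ (k0.choose d : ℝ) := Nat.pow_le_choose d k0
  have h2 : η * n < k0 + 1 := Nat.lt_floor_add_one _
  have h3 : η / 2 * n ≤ ((k0 + 1 - d : ℕ) : ℝ) := by
    have : ((k0 + 1 : ℕ) : ℝ) ≤ ((k0 + 1 - d : ℕ) : ℝ) + d := by exact_mod_cast (by omega)
    push_cast at this
    linarith
  have h4 : (η / 2 * n) ^ d / d.factorial ≤ (k0.choose d : ℝ) :=
    le_trans (by gcongr) h1
  have h5 : ((d : ℝ) + 1) * m < (k0.choose d : ℝ) := by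
    refine lt_of_lt_of_le ?_ h4
    have hd : (0 : ℝ) < d + 1 := by positivity
    calc ((d : ℝ) + 1) * m < (d + 1) * ((η / 2) ^ d / (d.factorial * (d + 1)) * (n : ℝ) ^ d) := by gcongr
      _ = _ := by rw [mul_pow]; field_simp
  exact_mod_cast h5

/-- For `d ≥ 2` and `c > 0`, there is `δ > 0` such that a.a.s. every
nonzero kernel vector of `∂_d(Y_d(n,c/n))` with inclusion-minimal support either is
supported on the boundary of a `(d+1)`-simplex or has support of size at least `δ n^d`. -/
theorem statement4 (d : ℕ) (hd : 2 ≤ d) (c : ℝ) (hc : 0 < c) :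
    ∃ δ : ℝ, 0 < δ ∧
      Filter.Tendsto (fun n : ℕ =>
        probY n d (c / n) (fun F =>
          ∀ z : ↥F → ℝ, z ∈ LinearMap.ker (boundaryMap n F) → z ≠ 0 →
            (∀ w : ↥F → ℝ, w ∈ LinearMap.ker (boundaryMap n F) → w ≠ 0 →
              suppOf w ⊆ suppOf z → suppOf w = suppOf z) →
            ((∃ τ : Finset (Fin n), τ.card = d + 2 ∧
                suppOf z = τ.powerset.filter (fun s => s.card = d + 1)) ∨
              δ * (n : ℝ) ^ d ≤ ((suppOf z).card : ℝ))))
        atTop (nhds 1) := by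
  set A : ℝ := 4 * ((d : ℝ) + 1) * Real.exp 1 * c with hA
  have hA0 : 0 < A := by positivity
  obtain ⟨ρ, hρ0, hρ1, hρA⟩ : ∃ ρ : ℝ, 0 < ρ ∧ ρ ≤ 1 ∧ A * ρ ≤ 1 / 2 := by
    refine ⟨min 1 (1 / (2 * A)), by positivity, min_le_left _ _, ?_⟩
    calc A * min 1 (1 / (2 * A)) ≤ A * (1 / (2 * A)) := by gcongr; exact min_le_right _ _
      _ = 1 / 2 := by field_simp
  have hρc : 4 * ((d : ℝ) + 1) * ρ * Real.exp 1 * c ≤ 1 / 2 := by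
    rw [hA] at hρA; linarith
  set η : ℝ := ρ ^ (5 * (d + 2)) with hη
  have hη0 : 0 < η := by positivity
  refine ⟨(η / 2) ^ d / (d.factorial * (d + 1)), by positivity, ?_⟩
  set δ : ℝ := (η / 2) ^ d / (d.factorial * (d + 1)) with hδ
  set S : ℝ := ∑' m : ℕ, (m + 1 : ℝ) * (m : ℝ) ^ (((d + 1) * (d + 2) * (d + 1)) * (d + 2)) * (1 / 2) ^ m with hS
  have hcast : Tendsto (fun n : ℕ => (n : ℝ)) atTop atTop := tendsto_natCast_atTop_atTop
  have hrt : Tendsto (fun n : ℕ => c * (n : ℝ) ^ (-(1 / (((d + 1) * (d + 2) : ℕ) : ℝ)))) atTop (nhds 0) := by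
    have h := (tendsto_rpow_neg_atTop (y := 1 / (((d + 1) * (d + 2) : ℕ) : ℝ)) (by positivity)).comp hcast
    have h' := h.const_mul c
    rw [mul_zero] at h'
    exact h'
  have hit : Tendsto (fun n : ℕ => (n : ℝ)⁻¹ * S) atTop (nhds 0) := by
    have h := (tendsto_inv_atTop_zero.comp hcast).mul_const S
    rw [zero_mul] at h
    exact h
  have hlow : Tendsto (fun n : ℕ => 1 - (4 * (c * (n : ℝ) ^ (-(1 / (((d + 1) * (d + 2) : ℕ) : ℝ)))) +
      (n : ℝ)⁻¹ * S)) atTop (nhds 1) := by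
    have := ((hrt.const_mul 4).add hit).const_sub 1
    simpa using this
  have hev : ∀ᶠ n : ℕ in atTop, 2 ≤ n ∧ c ≤ n ∧ 2 * d ≤ η * n ∧
      c * (n : ℝ) ^ (-(1 / (((d + 1) * (d + 2) : ℕ) : ℝ))) ≤ 1 / 2 := by
    have e1 := eventually_ge_atTop (α := ℕ) 2
    have e2 := hcast.eventually_ge_atTop c
    have e3 := hcast.eventually_ge_atTop (2 * d / η)
    have e4 := hrt.eventually_le_const (u := 1 / 2) (by norm_num)
    filter_upwards [e1, e2, e3, e4] with n h1 h2 h3 h4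
    refine ⟨h1, h2, ?_, h4⟩
    rw [div_le_iff₀ hη0] at h3
    linarith
  have hmain : ∀ᶠ n : ℕ in atTop, 1 - (4 * (c * (n : ℝ) ^ (-(1 / (((d + 1) * (d + 2) : ℕ) : ℝ)))) +
      (n : ℝ)⁻¹ * S) ≤ probY n d (c / n) (fun F =>
          ∀ z : ↥F → ℝ, z ∈ LinearMap.ker (boundaryMap n F) → z ≠ 0 →
            (∀ w : ↥F → ℝ, w ∈ LinearMap.ker (boundaryMap n F) → w ≠ 0 →
              suppOf w ⊆ suppOf z → suppOf w = suppOf z) →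
            ((∃ τ : Finset (Fin n), τ.card = d + 2 ∧
                suppOf z = τ.powerset.filter (fun s => s.card = d + 1)) ∨
              δ * (n : ℝ) ^ d ≤ ((suppOf z).card : ℝ))) ∧
      probY n d (c / n) (fun F =>
          ∀ z : ↥F → ℝ, z ∈ LinearMap.ker (boundaryMap n F) → z ≠ 0 →
            (∀ w : ↥F → ℝ, w ∈ LinearMap.ker (boundaryMap n F) → w ≠ 0 →
              suppOf w ⊆ suppOf z → suppOf w = suppOf z) →
            ((∃ τ : Finset (Fin n), τ.card = d + 2 ∧
                suppOf z = τ.powerset.filter (fun s => s.card = d + 1)) ∨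
              δ * (n : ℝ) ^ d ≤ ((suppOf z).card : ℝ))) ≤ 1 := by
    filter_upwards [hev] with n hn
    obtain ⟨hn2, hcn, hnd, hr⟩ := hn
    have hn0 : (0 : ℝ) < n := by positivity
    have hub := union_bound (n := n) (d := d) (c / n) (by positivity) (by rw [div_le_one hn0]; exact hcn)
      (fun F =>
          ∀ z : ↥F → ℝ, z ∈ LinearMap.ker (boundaryMap n F) → z ≠ 0 →
            (∀ w : ↥F → ℝ, w ∈ LinearMap.ker (boundaryMap n F) → w ≠ 0 →
              suppOf w ⊆ suppOf z → suppOf w = suppOf z) →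
            ((∃ τ : Finset (Fin n), τ.card = d + 2 ∧
                suppOf z = τ.powerset.filter (fun s => s.card = d + 1)) ∨
              δ * (n : ℝ) ^ d ≤ ((suppOf z).card : ℝ)))
      ⌈δ * (n : ℝ) ^ d⌉₊ ?_
    · refine ⟨le_trans ?_ hub.1, hub.2⟩
      have := bad_sum hd hn2 ⌈δ * (n : ℝ) ^ d⌉₊ ⌊η * n⌋₊ ρ c hc hρ0 hρ1 hρc
        (Nat.floor_le (by positivity)) (fun m hm => choose_large d n η hη0 hnd m
          (Nat.lt_ceil.mp (mem_range.mp hm))) hr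
      linarith
    · intro F hF hE
      push Not at hE
      obtain ⟨z, hz, hz0, hmin, hns, hlt⟩ := hE
      rcases reduction hF hz hz0 hmin with ⟨τ, h1, h2⟩ | ⟨K, hKF, hKz, hK, hKs⟩
      · exact absurd h2 (hns τ h1)
      · refine ⟨K.card, ?_, K, ?_, hKF⟩
        · rw [mem_range, Nat.lt_ceil]
          refine lt_of_le_of_lt ?_ hlt
          exact_mod_cast card_le_card hKz
        · rw [ncores, mem_filter, cores, mem_filter, mem_powerset]
          exact ⟨⟨hKF.trans hF, hK, rfl⟩, hKs⟩
  exact tendsto_of_tendsto_of_tendsto_of_le_of_le' hlow tendsto_const_nhds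
    (hmain.mono fun n h => h.1) (hmain.mono fun n h => h.2)

end
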